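/- arXiv:math/9801078 — 9 statements merged into one kernel-verified Lean document; each statement's English description precedes it below -/
import Mathlib

section
/- Let (M, π^M, ρ^M) and (N, π^N, ρ^N) be coherent models with κ_M ≤ κ_N. If M ∩ N is cofinal in M (i.e. for every α ∈ M there is γ ∈ M ∩ N with α < γ), then M ⊆ N. -/
open Cardinal Set

namespace PKL

/-- The order type of a set of ordinals (as an ordinal one universe up). -/
noncomputable def otp (s : Set Ordinal.{0}) : Ordinal.{1} :=
  Ordinal.type ((· < ·) : s → s → Prop)

/-- `𝒫_κ A` : all subsets of `A` of cardinality `< κ`. -/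
def PSet (κ : Cardinal.{0}) (A : Set Ordinal.{0}) : Set (Set Ordinal.{0}) :=
  {x | x ⊆ A ∧ #x < Cardinal.lift.{1} κ}

/-- `C` is closed unbounded in `𝒫_κ A`: it is `⊆`-cofinal and closed under
unions of `⊆`-increasing chains of length `< κ`. -/
def IsClub (κ : Cardinal.{0}) (A : Set Ordinal.{0}) (C : Set (Set Ordinal.{0})) : Prop :=
  C ⊆ PSet κ A ∧
  (∀ x ∈ PSet κ A, ∃ y ∈ C, x ⊆ y) ∧
  (∀ δ : Ordinal.{0}, 0 < δ → δ < κ.ord → ∀ f : Ordinal.{0} → Set Ordinal.{0},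
    (∀ α β, α ≤ β → β < δ → f α ⊆ f β) →
    (∀ α < δ, f α ∈ C) → (⋃ α ∈ Set.Iio δ, f α) ∈ C)

/-- `S` is stationary in `𝒫_κ A`: it meets every closed unbounded set. -/
def IsStationary (κ : Cardinal.{0}) (A : Set Ordinal.{0}) (S : Set (Set Ordinal.{0})) : Prop :=
  ∀ C, IsClub κ A C → (S ∩ C).Nonempty

/-- `κ⁺` as an ordinal: the initial ordinal of the successor cardinal of `κ`. -/
noncomputable def succOrd (κ : Cardinal.{0}) : Ordinal.{0} := (Order.succ κ).ord

/-- The ordinal `δ` is a limit cardinal. -/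
def IsLimitCardOrd (δ : Ordinal.{0}) : Prop :=
  δ.card.ord = δ ∧ ℵ₀ ≤ δ.card ∧ ∀ c < δ.card, Order.succ c < δ.card

/-- The ordinal `δ` is an inaccessible cardinal. -/
def IsInaccessibleOrd (δ : Ordinal.{0}) : Prop :=
  δ.card.ord = δ ∧ δ.card.IsInaccessible

/-- `E₀ = {x ∈ 𝒫_κ κ⁺ : κ_x is a limit cardinal and cf κ_x = cf λ_x}`. -/
noncomputable def E0 (κ : Cardinal.{0}) : Set (Set Ordinal.{0}) :=
  {x | x ∈ PSet κ (Iio (succOrd κ)) ∧ ∃ δ : Ordinal.{0},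
    x ∩ Iio κ.ord = Iio δ ∧ IsLimitCardOrd δ ∧ Cardinal.lift.{1} δ.cof = (otp x).cof}

/-- `E₁ = {x ∈ 𝒫_κ κ⁺ : κ_x is inaccessible and λ_x = κ_x⁺}`. -/
noncomputable def E1 (κ : Cardinal.{0}) : Set (Set Ordinal.{0}) :=
  {x | x ∈ PSet κ (Iio (succOrd κ)) ∧ ∃ δ : Ordinal.{0},
    x ∩ Iio κ.ord = Iio δ ∧ IsInaccessibleOrd δ ∧ otp x = Ordinal.lift.{1} (succOrd δ.card)}

/-- A model `(M, π, ρ)`: `M ∈ 𝒫_κ κ⁺`, `M ∩ κ` is the ordinal `κM`, the order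
type of `M` is at most `|κM|⁺`; for `α ∈ M \ κ`, `π_α` maps `M ∩ α` into `M ∩ α`
and maps `κM` onto `M ∩ α`; for `α ∈ M \ κ` and `β < κM`, `β ≤ ρ_α β < κM`.
(`π` and `ρ` are coded as total functions; only their values on the domains
described above are meaningful.) -/
structure OModel (κ : Cardinal.{0}) where
  M : Set Ordinal.{0}
  κM : Ordinal.{0}
  π : Ordinal.{0} → Ordinal.{0} → Ordinal.{0}
  ρ : Ordinal.{0} → Ordinal.{0} → Ordinal.{0}
  sub : M ⊆ Iio (succOrd κ)
  card_lt : #M < Cardinal.lift.{1} κ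
  inter : M ∩ Iio κ.ord = Iio κM
  otp_le : otp M ≤ Ordinal.lift.{1} ((Order.succ κM.card).ord)
  π_mem : ∀ α ∈ M, κ.ord ≤ α → ∀ β ∈ M, β < α → π α β ∈ M ∧ π α β < α
  π_onto : ∀ α ∈ M, κ.ord ≤ α → ∀ γ ∈ M, γ < α → ∃ β < κM, π α β = γ
  ρ_spec : ∀ α ∈ M, κ.ord ≤ α → ∀ β < κM, β ≤ ρ α β ∧ ρ α β < κM

/-- Two models are coherent: their `π`'s and `ρ`'s agree wherever both are defined. -/
def Coherent {κ : Cardinal.{0}} (A B : OModel κ) : Prop :=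
  (∀ α ∈ A.M ∩ B.M, κ.ord ≤ α → ∀ β ∈ A.M ∩ B.M, β < α → A.π α β = B.π α β) ∧
  (∀ α ∈ A.M ∩ B.M, κ.ord ≤ α → ∀ β : Ordinal.{0}, β < A.κM → β < B.κM →
    A.ρ α β = B.ρ α β)

/-- `A` is a submodel of `B`: `A.M ⊆ B.M` and `π^A ⊆ π^B`, `ρ^A ⊆ ρ^B`. -/
def Submodel {κ : Cardinal.{0}} (A B : OModel κ) : Prop :=
  A.M ⊆ B.M ∧
  (∀ α ∈ A.M, κ.ord ≤ α → ∀ β ∈ A.M, β < α → A.π α β = B.π α β) ∧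
  (∀ α ∈ A.M, κ.ord ≤ α → ∀ β < A.κM, A.ρ α β = B.ρ α β)

/-- A condition in `Q(S)` (for `S` a stationary subset of `E₀`),
Definition 3.3 of the paper. -/
structure IsCondition (κ : Cardinal.{0}) (S : Set (Set Ordinal.{0})) (A : OModel κ) :
    Prop where
  /-- `M` is `ω`-closed. -/
  omega_closed : ∀ γ : Ordinal.{0}, γ.cof = ℵ₀ → sSup (A.M ∩ Iio γ) = γ → γ ∈ A.M
  /-- Clause (ii) of Definition 3.3. -/
  sup_prop : ∀ α ∈ A.M, κ.ord ≤ α → ∀ β < A.κM, ∀ γ : Ordinal.{0}, A.κM ≤ γ → γ < α →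
    ∀ f : ℕ → Ordinal.{0}, (∀ n, f n < β) → γ = ⨆ n, A.π α (f n) →
    ∃ ζ < A.ρ α β, γ = A.π α ζ
  /-- Clause (iii): for every submodel `a ∈ E₁`, `S ∩ 𝒫_{κ_a} a` is stationary
  in `𝒫_{κ_a} a`. -/
  reflect : ∀ a : OModel κ, Submodel a A → a.M ∈ E1 κ →
    IsStationary a.κM.card a.M (S ∩ PSet a.κM.card a.M)

/-- `N` is a stronger condition than `M`. -/
def Stronger {κ : Cardinal.{0}} (N M : OModel κ) : Prop :=
  Submodel M N ∧ #M.M < Cardinal.lift.{1} N.κM.card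

/-- Lemma 3.2: if `M` and `N` are coherent models with `κ_M ≤ κ_N` and
`M ∩ N` is cofinal in `M`, then `M ⊆ N`. -/
theorem stmt0 (κ : Cardinal.{0}) (hreg : κ.IsRegular) (hunc : ℵ₀ < κ)
    (M N : OModel κ) (hcoh : Coherent M N) (hκ : M.κM ≤ N.κM)
    (hcof : ∀ α ∈ M.M, ∃ γ ∈ M.M ∩ N.M, α < γ) :
    M.M ⊆ N.M := by
  have mem_of_lt (A : OModel κ) {β : Ordinal.{0}} (hβ : β < A.κM) : β ∈ A.M ∩ Iio κ.ord := by
    rw [A.inter]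
    exact hβ
  intro α hα
  obtain ⟨γ, hγ, hαγ⟩ := hcof α hα
  rcases lt_or_ge α κ.ord with hακ | hκα
  · have h : α < M.κM := by
      have : α ∈ M.M ∩ Iio κ.ord := ⟨hα, hακ⟩
      rwa [M.inter] at this
    exact (mem_of_lt N (h.trans_le hκ)).1
  · have hκγ : κ.ord ≤ γ := hκα.trans hαγ.le
    obtain ⟨β, hβ, rfl⟩ := M.π_onto γ hγ.1 hκγ α hα hαγ
    have hβM := mem_of_lt M hβ
    have hβN := mem_of_lt N (hβ.trans_le hκ)
    have hβγ : β < γ := lt_of_lt_of_le hβM.2 hκγ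
    rw [hcoh.1 γ hγ hκγ β ⟨hβM.1, hβN.1⟩ hβγ]
    exact (N.π_mem γ hγ.2 hκγ β hβN.1 hβγ).1

end PKL
end

section
/- Let S be a stationary subset of E_0, let M be a condition in Q(S), and let δ < κ and κ ≤ ε < κ⁺. Then there is a condition N in Q(S) stronger than M such that δ ∈ N and ε ∈ N. -/
open Cardinal Set

namespace PKL

theorem exists_surjOn_of_mk_le {α : Type*} {A B : Set α} (hB : B.Nonempty) (h : #B ≤ #A) :
    ∃ g : α → α, (∀ x, g x ∈ B) ∧ ∀ y ∈ B, ∃ x ∈ A, g x = y := by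
  classical
  obtain ⟨e⟩ := h
  obtain ⟨b, hb⟩ := hB
  refine ⟨fun x => if hx : ∃ y : B, (e y : α) = x then (hx.choose : α) else b, fun x => ?_,
    fun y hy => ⟨e ⟨y, hy⟩, (e ⟨y, hy⟩).2, ?_⟩⟩
  · dsimp only
    split_ifs with hx
    · exact hx.choose.2
    · exact hb
  · have hx : ∃ z : B, (e z : α) = e ⟨y, hy⟩ := ⟨_, rfl⟩
    dsimp only
    rw [dif_pos hx]
    exact congrArg Subtype.val (e.injective (Subtype.ext hx.choose_spec))

theorem exists_mem_between_of_sSup_inter_Iio_eq {X : Set Ordinal.{0}} {γ b : Ordinal.{0}}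
    (h : sSup (X ∩ Iio γ) = γ) (hb : b < γ) : ∃ x ∈ X, b < x ∧ x < γ := by
  have hne : (X ∩ Iio γ).Nonempty := by
    rw [nonempty_iff_ne_empty]
    intro h0
    rw [h0, csSup_empty] at h
    rw [← h] at hb
    exact not_lt_bot hb
  obtain ⟨x, hx, hbx⟩ := exists_lt_of_lt_csSup hne (h.symm ▸ hb)
  exact ⟨x, hx.1, hbx, hx.2⟩

theorem sSup_inter_Iio_eq {X : Set Ordinal.{0}} {γ : Ordinal.{0}}
    (h : ∀ b < γ, ∃ x ∈ X, b < x ∧ x < γ) : sSup (X ∩ Iio γ) = γ := by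
  have hbdd : BddAbove (X ∩ Iio γ) := ⟨γ, fun x hx => hx.2.le⟩
  refine le_antisymm (csSup_le' fun x hx => hx.2.le) (le_of_forall_lt fun b hb => ?_)
  obtain ⟨x, hx, hbx, hxγ⟩ := h b hb
  exact hbx.trans_le (le_csSup hbdd ⟨hx, hxγ⟩)

theorem exists_mem_between_of_mem_union_singleton {X Y : Set Ordinal.{0}} {γ c ε : Ordinal.{0}}
    (hc : c < γ) (hY : ∀ y ∈ Y, c < y → y ∈ X ∨ y = ε)
    (h : ∀ b < γ, ∃ y ∈ Y, b < y ∧ y < γ) : ∀ b < γ, ∃ x ∈ X, b < x ∧ x < γ := by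
  intro b hb
  by_cases hε : ε < γ
  · obtain ⟨y, hy, hby, hyγ⟩ := h (max (max b c) ε) (max_lt (max_lt hb hc) hε)
    simp only [max_lt_iff] at hby
    refine ⟨y, (hY y hy hby.1.2).resolve_right hby.2.ne', hby.1.1, hyγ⟩
  · obtain ⟨y, hy, hby, hyγ⟩ := h (max b c) (max_lt hb hc)
    simp only [max_lt_iff] at hby
    exact ⟨y, (hY y hy hby.2).resolve_right (fun e => hε (e ▸ hyγ)), hby.1, hyγ⟩

/-- An `ω`-closed set contains the suprema of its countable sequences. -/
theorem iSup_nat_mem {X : Set Ordinal.{0}}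
    (hX : ∀ γ : Ordinal.{0}, γ.cof = ℵ₀ → sSup (X ∩ Iio γ) = γ → γ ∈ X)
    (f : ℕ → Ordinal.{0}) (hf : ∀ n, f n ∈ X) : (⨆ n, f n) ∈ X := by
  by_cases h : ∃ n, f n = ⨆ n, f n
  · obtain ⟨n, hn⟩ := h
    exact hn ▸ hf n
  push Not at h
  have hlt : ∀ n, f n < ⨆ n, f n := fun n => (Ordinal.le_iSup f n).lt_of_ne (h n)
  have hbet : ∀ b < ⨆ n, f n, ∃ n, b < f n := fun b hb => Ordinal.lt_iSup_iff.1 hb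
  apply hX
  · apply le_antisymm
    · by_contra! hcof
      exact (Ordinal.iSup_lt_of_lt_cof (by simpa using hcof) hlt).false
    · rw [Ordinal.aleph0_le_cof_iff, Ordinal.one_lt_cof_iff]
      refine ⟨fun hmin => not_lt_of_ge (hmin (hlt 0).le) (hlt 0), fun c hc => ?_⟩
      obtain ⟨n, hn⟩ := hbet c hc.lt
      exact hc.2 hn (hlt n)
  · refine sSup_inter_Iio_eq fun b hb => ?_
    obtain ⟨n, hn⟩ := hbet b hb
    exact ⟨f n, hf n, hn, hlt n⟩

/-- A bound below `θ` for the values of a function on the countable sequences below `β`. -/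
theorem exists_bound_of_power_lt {θ : Cardinal.{0}} (hθ : θ.IsRegular) {β : Ordinal.{0}}
    (hβ : β.card ^ ℵ₀ < θ) (F : (ℕ → Ordinal.{0}) → Ordinal.{0}) (hF : ∀ f, F f < θ.ord) :
    ∃ r < θ.ord, ∀ f : ℕ → Ordinal.{0}, (∀ n, f n < β) → F f ≤ r := by
  let G : (ℕ → β.ToType) → Ordinal.{0} :=
    fun s => F fun n => (Ordinal.ToType.mk.symm (s n) : Ordinal.{0})
  refine ⟨⨆ s, G s, Ordinal.iSup_lt_of_lt_cof ?_ fun s => hF _, fun f hf => ?_⟩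
  · rw [hθ.cof_ord]
    simpa using hβ
  · have := Ordinal.le_iSup G fun n => Ordinal.ToType.mk ⟨f n, hf n⟩
    simpa [G] using this

theorem mk_eq_card_otp (s : Set Ordinal.{0}) : #s = (otp s).card :=
  (Ordinal.card_type _).symm

theorem lift_le_mk_Ico {θ : Cardinal.{0}} (hθ : ℵ₀ ≤ θ) {a : Ordinal.{0}} (ha : a < θ.ord) :
    Cardinal.lift.{1} θ ≤ #(Ico a θ.ord) := by
  by_contra! h
  have h1 : #(Iio a) < Cardinal.lift.{1} θ := by
    rw [mk_Iio_ordinal, Cardinal.lift_lt]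
    exact lt_ord.1 ha
  have h2 : #(Iio θ.ord) ≤ #(Iio a) + #(Ico a θ.ord) := by
    rw [← Iio_union_Ico_eq_Iio ha.le]
    exact mk_union_le _ _
  rw [mk_Iio_ordinal, card_ord] at h2
  exact h2.not_gt (add_lt_of_lt (by simpa using hθ) h1 h)

theorem mk_Iio_union_insert_le {c : Cardinal.{0}} (hc : ℵ₀ ≤ c) {d : Ordinal.{0}}
    (hd : d.card ≤ c) {X : Set Ordinal.{0}} (hX : #X ≤ Cardinal.lift.{1} c) (ε : Ordinal.{0}) :
    #(Iio d ∪ insert ε X : Set Ordinal.{0}) ≤ Cardinal.lift.{1} c := by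
  have hc' : ℵ₀ ≤ Cardinal.lift.{1} c := by simpa using hc
  refine (mk_union_le _ _).trans (add_le_of_le hc' ?_ (mk_insert_le.trans
    (add_le_of_le hc' hX (one_le_aleph0.trans hc'))))
  rw [mk_Iio_ordinal, Cardinal.lift_le]
  exact hd

theorem exists_regular_of_isInaccessible {κ : Cardinal.{0}} (hκ : κ.IsInaccessible)
    {μ : Cardinal.{0}} (hμ : μ < κ) : ∃ θ : Cardinal.{0}, θ < κ ∧ μ < θ ∧ θ.IsRegular ∧
      ℵ₀ < θ ∧ ∀ c < θ, c ^ ℵ₀ < θ := by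
  have hν : max μ ℵ₀ < κ := max_lt hμ hκ.aleph0_lt
  have h1 : (2 : Cardinal.{0}) ^ max μ ℵ₀ < κ := hκ.isStrongPrelimit hν
  have h2 : (2 : Cardinal.{0}) ^ (2 : Cardinal.{0}) ^ max μ ℵ₀ < κ := hκ.isStrongPrelimit h1
  have hlt := Order.lt_succ ((2 : Cardinal.{0}) ^ max μ ℵ₀)
  have hμ2 : max μ ℵ₀ ≤ 2 ^ max μ ℵ₀ := (cantor _).le
  refine ⟨Order.succ (2 ^ max μ ℵ₀), (Order.succ_le_of_lt (cantor _)).trans_lt h2,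
    ((le_max_left _ _).trans hμ2).trans_lt hlt, isRegular_succ ((le_max_right _ _).trans hμ2),
    ((le_max_right _ _).trans hμ2).trans_lt hlt, fun c hc => ?_⟩
  refine (power_le_power_right (Order.lt_succ_iff.1 hc)).trans_lt ?_
  rwa [← power_mul, mul_eq_left (le_max_right _ _) (le_max_right _ _) aleph0_ne_zero]

/-- Lemma 3.4: for any condition `M` in `Q(S)` and any `δ < κ`, `κ ≤ ε < κ⁺`,
there is a condition `N` stronger than `M` with `δ ∈ N` and `ε ∈ N`. -/
theorem stmt1 (κ : Cardinal.{0}) (hκ : κ.IsInaccessible)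
    (S : Set (Set Ordinal.{0})) (hS0 : S ⊆ E0 κ)
    (hSstat : IsStationary κ (Iio (succOrd κ)) S)
    (M : OModel κ) (hM : IsCondition κ S M)
    (δ ε : Ordinal.{0}) (hδ : δ < κ.ord) (hε1 : κ.ord ≤ ε) (hε2 : ε < succOrd κ) :
    ∃ N : OModel κ, IsCondition κ S N ∧ Stronger N M ∧ δ ∈ N.M ∧ ε ∈ N.M := by
  classical
  obtain ⟨m, hmκ, hmM⟩ := Cardinal.lt_lift_iff.1 M.card_lt
  obtain ⟨θ, hθκ, hμθ, hreg, hℵθ, hpow⟩ := exists_regular_of_isInaccessible hκ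
    (max_lt hmκ (lt_ord.1 hδ))
  set μ := max m δ.card
  have hmμ : m ≤ μ := le_max_left _ _
  have hMθ : #M.M < Cardinal.lift.{1} θ := by
    rw [← hmM, Cardinal.lift_lt]
    exact hmμ.trans_lt hμθ
  have hθo : θ.ord < κ.ord := ord_lt_ord.2 hθκ
  have hκMsub : Iio M.κM ⊆ M.M := M.inter ▸ inter_subset_left
  have hκMm : M.κM.card ≤ m := by
    have h := mk_le_mk_of_subset hκMsub
    rwa [mk_Iio_ordinal, ← hmM, Cardinal.lift_le] at h
  have hκMθ : M.κM < θ.ord := lt_ord.2 (hκMm.trans_lt (hmμ.trans_lt hμθ))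
  have hMlow : ∀ x ∈ M.M, x < κ.ord → x < M.κM := fun x hx hxκ => by
    have : x ∈ M.M ∩ Iio κ.ord := ⟨hx, hxκ⟩
    rwa [M.inter] at this
  have hκsucc : κ.ord < succOrd κ := ord_lt_ord.2 (Order.lt_succ κ)
  have hθ0 : (0 : Ordinal.{0}) < θ.ord := by
    rw [lt_ord, Ordinal.card_zero]
    exact aleph0_pos.trans hℵθ
  set X : Set Ordinal.{0} := Iio θ.ord ∪ insert ε M.M
  have hMX : M.M ⊆ X := fun x hx => Or.inr (Or.inr hx)
  have hXhigh : ∀ x ∈ X, θ.ord ≤ x → x ∈ M.M ∨ x = ε := by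
    rintro x (hx | hx | hx) hθx
    · exact absurd hx (not_lt.2 hθx)
    · exact Or.inr hx
    · exact Or.inl hx
  have hXinter : X ∩ Iio κ.ord = Iio θ.ord := by
    ext x
    constructor
    · rintro ⟨hx, hxκ⟩
      by_contra hxθ
      obtain h | h := hXhigh x hx (not_lt.1 hxθ)
      · exact hxθ ((hMlow x h hxκ).trans hκMθ)
      · exact absurd (h ▸ hxκ : ε < κ.ord) (not_lt.2 hε1)
    · exact fun hx => ⟨Or.inl hx, lt_trans hx hθo⟩
  have hXcard : #X ≤ Cardinal.lift.{1} θ :=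
    mk_Iio_union_insert_le hℵθ.le (card_ord θ).le hMθ.le ε
  have hXclosed : ∀ γ : Ordinal.{0}, γ.cof = ℵ₀ → sSup (X ∩ Iio γ) = γ → γ ∈ X := by
    intro γ hcof hsup
    by_cases hγ : γ ≤ θ.ord
    · refine Or.inl (lt_of_le_of_ne hγ ?_)
      rintro rfl
      rw [hreg.cof_ord] at hcof
      exact hℵθ.ne' hcof
    · refine hMX (hM.omega_closed γ hcof (sSup_inter_Iio_eq ?_))
      exact exists_mem_between_of_mem_union_singleton (not_le.1 hγ)
        (fun y hy h => hXhigh y hy h.le)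
        (fun b hb => exists_mem_between_of_sSup_inter_Iio_eq hsup hb)
  have hg : ∀ α : Ordinal.{0}, ∃ g : Ordinal.{0} → Ordinal.{0}, κ.ord ≤ α →
      (∀ β, g β ∈ X ∩ Iio α) ∧ ∀ γ ∈ X ∩ Iio α, ∃ β ∈ Ico M.κM θ.ord, g β = γ := by
    intro α
    by_cases hα : κ.ord ≤ α
    · obtain ⟨g, h1, h2⟩ := exists_surjOn_of_mk_le (A := Ico M.κM θ.ord) (B := X ∩ Iio α)
        ⟨0, Or.inl hθ0, (hθ0.trans hθo).trans_le hα⟩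
        ((mk_le_mk_of_subset inter_subset_left).trans
          (hXcard.trans (lift_le_mk_Ico hℵθ.le hκMθ)))
      exact ⟨g, fun _ => ⟨h1, h2⟩⟩
    · exact ⟨id, fun h => absurd h hα⟩
  choose g hg using hg
  let p : Ordinal.{0} → Ordinal.{0} → Ordinal.{0} :=
    fun α β => if α ∈ M.M ∧ β ∈ M.M then M.π α β else g α β
  have hpM : ∀ α ∈ M.M, ∀ β ∈ M.M, p α β = M.π α β := fun α hα β hβ => if_pos ⟨hα, hβ⟩
  have hpmem : ∀ α ∈ X, κ.ord ≤ α → ∀ β ∈ X, β < α → p α β ∈ X ∧ p α β < α := by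
    intro α _ hκα β _ hβα
    by_cases h : α ∈ M.M ∧ β ∈ M.M
    · rw [hpM α h.1 β h.2]
      obtain ⟨h1, h2⟩ := M.π_mem α h.1 hκα β h.2 hβα
      exact ⟨hMX h1, h2⟩
    · simp only [p, if_neg h]
      exact (hg α hκα).1 β
  have hponto : ∀ α ∈ X, κ.ord ≤ α → ∀ γ ∈ X, γ < α → ∃ β < θ.ord, p α β = γ := by
    intro α _ hκα γ hγ hγα
    obtain ⟨β, ⟨hβ1, hβ2⟩, hβ⟩ := (hg α hκα).2 γ ⟨hγ, hγα⟩
    refine ⟨β, hβ2, ?_⟩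
    have h : ¬ (α ∈ M.M ∧ β ∈ M.M) := fun h =>
      (hMlow β h.2 (hβ2.trans hθo)).not_ge hβ1
    simp only [p, if_neg h, hβ]
  have hh : ∀ α β : Ordinal.{0}, ∃ r, α ∈ X → κ.ord ≤ α → β < θ.ord →
      r < θ.ord ∧ β ≤ r ∧ μ.ord ≤ r ∧ ∀ γ : Ordinal.{0}, γ < α →
        ∀ f : ℕ → Ordinal.{0}, (∀ n, f n < β) → γ = ⨆ n, p α (f n) → ∃ ζ < r, γ = p α ζ := by
    intro α β
    by_cases hαβ : α ∈ X ∧ κ.ord ≤ α ∧ β < θ.ord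
    swap
    · exact ⟨0, fun h1 h2 h3 => absurd ⟨h1, h2, h3⟩ hαβ⟩
    obtain ⟨hα, hκα, hβ⟩ := hαβ
    have hF : ∀ f : ℕ → Ordinal.{0}, ∃ ζ < θ.ord, (∀ n, f n < β) → (⨆ n, p α (f n)) < α →
        (⨆ n, p α (f n)) = p α ζ := by
      intro f
      by_cases hf : (∀ n, f n < β) ∧ (⨆ n, p α (f n)) < α
      · obtain ⟨hf, hfα⟩ := hf
        have hmem : (⨆ n, p α (f n)) ∈ X := iSup_nat_mem hXclosed _ fun n =>
          have hfθ : f n < θ.ord := (hf n).trans hβ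
          (hpmem α hα hκα (f n) (Or.inl hfθ) ((hfθ.trans hθo).trans_le hκα)).1
        obtain ⟨ζ, hζ, h⟩ := hponto α hα hκα _ hmem hfα
        exact ⟨ζ, hζ, fun _ _ => h.symm⟩
      · exact ⟨0, hθ0, fun h1 h2 => absurd ⟨h1, h2⟩ hf⟩
    choose F hFθ hF using hF
    obtain ⟨r, hr, hFr⟩ := exists_bound_of_power_lt hreg (hpow _ (lt_ord.1 hβ)) F hFθ
    have hlim : Order.IsSuccLimit θ.ord := isSuccLimit_ord hℵθ.le
    refine ⟨max (max β μ.ord) (Order.succ r), fun _ _ _ =>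
      ⟨max_lt (max_lt hβ (ord_lt_ord.2 hμθ)) (hlim.succ_lt hr),
        (le_max_left _ _).trans (le_max_left _ _), (le_max_right _ _).trans (le_max_left _ _), ?_⟩⟩
    rintro γ hγ f hf rfl
    exact ⟨F f, ((Order.lt_succ_iff.2 (hFr f hf)).trans_le (le_max_right _ _)), hF f hf hγ⟩
  choose h hh using hh
  let q : Ordinal.{0} → Ordinal.{0} → Ordinal.{0} :=
    fun α β => if α ∈ M.M ∧ β < M.κM then M.ρ α β else h α β
  have hqM : ∀ α ∈ M.M, ∀ β < M.κM, q α β = M.ρ α β := fun α hα β hβ => if_pos ⟨hα, hβ⟩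
  let N : OModel κ :=
    { M := X
      κM := θ.ord
      π := p
      ρ := q
      sub := by
        rintro x (hx | rfl | hx)
        · exact (lt_trans hx hθo).trans hκsucc
        · exact hε2
        · exact M.sub hx
      card_lt := hXcard.trans_lt (Cardinal.lift_lt.2 hθκ)
      inter := hXinter
      otp_le := by
        rw [lift_ord]
        refine (lt_ord.2 ?_).le
        rw [← mk_eq_card_otp, card_ord]
        exact hXcard.trans_lt (Cardinal.lift_lt.2 (Order.lt_succ θ))
      π_mem := hpmem
      π_onto := hponto
      ρ_spec := by
        intro α hα hκα β hβ
        by_cases hc : α ∈ M.M ∧ β < M.κM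
        · rw [hqM α hc.1 β hc.2]
          obtain ⟨h1, h2⟩ := M.ρ_spec α hc.1 hκα β hc.2
          exact ⟨h1, h2.trans hκMθ⟩
        · simp only [q, if_neg hc]
          obtain ⟨h1, h2, -⟩ := hh α β hα hκα hβ
          exact ⟨h2, h1⟩ }
  refine ⟨N, ⟨hXclosed, ?_, ?_⟩, ⟨⟨hMX, ?_, ?_⟩, ?_⟩, Or.inl ?_, Or.inr (Or.inl rfl)⟩
  · intro α hα hκα β hβ γ hγ hγα f hf hsup
    change γ = ⨆ n, p α (f n) at hsup
    change ∃ ζ < q α β, γ = p α ζ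
    by_cases hc : α ∈ M.M ∧ β < M.κM
    · obtain ⟨hαM, hβM⟩ := hc
      rw [hqM α hαM β hβM]
      have hfM : ∀ n, p α (f n) = M.π α (f n) := fun n =>
        hpM α hαM (f n) (hκMsub ((hf n).trans hβM))
      simp only [hfM] at hsup
      obtain ⟨ζ, hζ, hγζ⟩ := hM.sup_prop α hαM hκα β hβM γ (hκMθ.le.trans hγ) hγα f hf hsup
      refine ⟨ζ, hζ, ?_⟩
      rw [hpM α hαM ζ (hκMsub (hζ.trans (M.ρ_spec α hαM hκα β hβM).2)), hγζ]
    · simp only [q, if_neg hc]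
      exact (hh α β hα hκα hβ).2.2.2 γ hγα f hf hsup
  · rintro a ⟨haN, haπ, haρ⟩ haE
    obtain ⟨-, d, hd, ⟨hdcard, hdin⟩, hotp⟩ := haE
    obtain rfl : a.κM = d := Iio_injective (a.inter.symm.trans hd)
    have hdℵ : ℵ₀ ≤ a.κM.card := hdin.aleph0_lt.le
    have hacard : #a.M = Cardinal.lift.{1} (Order.succ a.κM.card) := by
      rw [mk_eq_card_otp, hotp, succOrd, Cardinal.lift_ord, card_ord]
    have hasub : ∀ x ∈ a.M, x < a.κM ∨ x ∈ M.M ∨ x = ε := by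
      intro x hx
      by_cases hxκ : x < κ.ord
      · left
        have : x ∈ a.M ∩ Iio κ.ord := ⟨hx, hxκ⟩
        rwa [a.inter] at this
      · exact Or.inr (hXhigh x (haN hx) (hθo.le.trans (not_lt.1 hxκ)))
    have hbig : ¬ #M.M ≤ Cardinal.lift.{1} a.κM.card := by
      intro hle
      have hsub : a.M ⊆ Iio a.κM ∪ insert ε M.M := fun x hx => by
        obtain h1 | h1 | h1 := hasub x hx
        · exact Or.inl h1
        · exact Or.inr (Or.inr h1)
        · exact Or.inr (Or.inl h1)
      have := (mk_le_mk_of_subset hsub).trans (mk_Iio_union_insert_le hdℵ le_rfl hle ε)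
      rw [hacard, Cardinal.lift_le] at this
      exact this.not_gt (Order.lt_succ _)
    have hεa : ε ∈ a.M → ε ∈ M.M := by
      intro hεa
      by_contra hεM
      apply hbig
      have h0 : (0 : Ordinal.{0}) < a.κM := by
        rw [pos_iff_ne_zero]
        intro h0
        rw [h0, Ordinal.card_zero] at hdℵ
        exact hdℵ.not_gt aleph0_pos
      have h1 := (a.ρ_spec ε hεa hε1 0 h0).2
      rw [haρ ε hεa hε1 0 h0] at h1
      change q ε 0 < a.κM at h1
      simp only [q, hεM, false_and, if_false] at h1
      have h2 := (hh ε 0 (Or.inr (Or.inl rfl)) hε1 hθ0).2.2.1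
      rw [← hmM, Cardinal.lift_le]
      exact hmμ.trans (ord_le.1 (h2.trans h1.le))
    have hκle : a.κM ≤ M.κM := by
      by_contra! hlt
      apply hbig
      have h1 : M.κM.card < a.κM.card := lt_ord.1 (hdcard.symm ▸ hlt)
      have h2 := Ordinal.card_le_card M.otp_le
      rw [← mk_eq_card_otp, Cardinal.lift_ord, card_ord] at h2
      exact h2.trans (Cardinal.lift_le.2 (Order.succ_le_of_lt h1))
    have haM : a.M ⊆ M.M := by
      intro x hx
      obtain h1 | h1 | h1 := hasub x hx
      · exact hκMsub (h1.trans_le hκle)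
      · exact h1
      · exact h1 ▸ hεa (h1 ▸ hx)
    refine hM.reflect a ⟨haM, fun α hα hκα β hβ hβα => ?_, fun α hα hκα β hβ => ?_⟩
      ⟨⟨a.sub, a.card_lt⟩, a.κM, hd, ⟨hdcard, hdin⟩, hotp⟩
    · exact (haπ α hα hκα β hβ hβα).trans (hpM α (haM hα) β (haM hβ))
    · exact (haρ α hα hκα β hβ).trans (hqM α (haM hα) β (hβ.trans_le hκle))
  · exact fun α hα _ β hβ _ => (hpM α hα β hβ).symm
  · exact fun α hα _ β hβ => (hqM α hα β hβ).symm
  · change #M.M < Cardinal.lift.{1} θ.ord.card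
    rwa [card_ord]
  · exact lt_ord.2 ((le_max_right _ _).trans_lt hμθ)

end PKL
end

section
/- Let S be a stationary subset of E_0 and let (M_1, π_1, ρ_1) and (M_2, π_2, ρ_2) be conditions in Q(S) such that κ_{M_1} = κ_{M_2} and the models M_1 and M_2 are coherent. Then the two conditions are compatible, i.e. there exists a condition N in Q(S) stronger than both M_1 and M_2. -/
open Cardinal Set

namespace PKL

/-- A set closed under limits of cofinality `ω` is closed under suprema of sequences. -/
theorem iSup_mem_of_omega_closed {N : Set Ordinal.{0}}
    (hN : ∀ γ : Ordinal.{0}, γ.cof = ℵ₀ → sSup (N ∩ Iio γ) = γ → γ ∈ N)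
    (g : ℕ → Ordinal.{0}) (hg : ∀ n, g n ∈ N) : (⨆ n, g n) ∈ N := by
  by_cases h : ∃ n, g n = ⨆ n, g n
  · obtain ⟨n, hn⟩ := h
    exact hn ▸ hg n
  push Not at h
  have hlt : ∀ n, g n < ⨆ n, g n := fun n => (Ordinal.le_iSup g n).lt_of_ne (h n)
  apply hN
  · apply le_antisymm
    · by_contra! hcof
      exact (Ordinal.iSup_lt_of_lt_cof (by simpa using hcof) hlt).false
    · rw [Ordinal.aleph0_le_cof_iff, Ordinal.one_lt_cof_iff, Ordinal.isSuccLimit_iff, Order.isSuccPrelimit_iff_succ_lt]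
      refine ⟨(bot_le.trans_lt (hlt 0)).ne', fun a ha => ?_⟩
      obtain ⟨n, hn⟩ := (Ordinal.lt_iSup_iff).1 ha
      exact (Order.succ_le_of_lt hn).trans_lt (hlt n)
  · apply le_antisymm
    · exact csSup_le ⟨g 0, hg 0, hlt 0⟩ fun x hx => hx.2.le
    · exact Ordinal.iSup_le fun n => le_csSup ⟨⨆ n, g n, fun x hx => hx.2.le⟩ ⟨hg n, hlt n⟩

/-- Adjoining an initial segment of uncountable cofinality to two `ω`-closed sets
produces an `ω`-closed set. -/
theorem omega_closed_union {A B : Set Ordinal.{0}} {μ : Ordinal.{0}} (hμ : μ.cof ≠ ℵ₀)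
    (hA : ∀ γ : Ordinal.{0}, γ.cof = ℵ₀ → sSup (A ∩ Iio γ) = γ → γ ∈ A)
    (hB : ∀ γ : Ordinal.{0}, γ.cof = ℵ₀ → sSup (B ∩ Iio γ) = γ → γ ∈ B)
    (γ : Ordinal.{0}) (hγ : γ.cof = ℵ₀) (hs : sSup ((A ∪ B ∪ Iio μ) ∩ Iio γ) = γ) :
    γ ∈ A ∪ B ∪ Iio μ := by
  by_contra hn
  simp only [mem_union, mem_Iio, not_or, not_lt] at hn
  obtain ⟨⟨hnA, hnB⟩, hμγ⟩ := hn
  have hμγ : μ < γ := hμγ.lt_of_ne (by rintro rfl; exact hμ hγ)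
  have hlt (C : Set Ordinal.{0})
      (hC : γ.cof = ℵ₀ → sSup (C ∩ Iio γ) = γ → γ ∈ C) (hnC : γ ∉ C) :
      sSup (C ∩ Iio γ) < γ :=
    (csSup_le' fun x hx => hx.2.le).lt_of_ne fun h => hnC (hC hγ h)
  have hA' := hlt A (hA γ) hnA
  have hB' := hlt B (hB γ) hnB
  have hle (C : Set Ordinal.{0}) {x} (hx : x ∈ C) (hxγ : x < γ) : x ≤ sSup (C ∩ Iio γ) :=
    le_csSup ⟨γ, fun x hx => hx.2.le⟩ ⟨hx, hxγ⟩
  have : sSup ((A ∪ B ∪ Iio μ) ∩ Iio γ) ≤ max (max (sSup (A ∩ Iio γ)) (sSup (B ∩ Iio γ))) μ := by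
    refine csSup_le' ?_
    rintro x ⟨(hx | hx) | hx, hxγ⟩
    · exact (hle A hx hxγ).trans ((le_max_left _ _).trans (le_max_left _ _))
    · exact (hle B hx hxγ).trans ((le_max_right _ _).trans (le_max_left _ _))
    · exact (le_of_lt hx).trans (le_max_right _ _)
  exact (hs ▸ this).not_gt (max_lt (max_lt hA' hB') hμγ)

/-- If `|β| ^ ℵ₀ < cf μ`, then witnesses below `μ` for all sequences from `β` can be bounded
below `μ`. -/
theorem exists_index_bound {μ β : Ordinal.{0}} (hβ : β < μ) (hcof : β.card ^ ℵ₀ < μ.cof)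
    {P : (ℕ → Ordinal.{0}) → Ordinal.{0} → Prop}
    (h : ∀ f : ℕ → Ordinal.{0}, (∀ n, f n < β) → ∃ ζ < μ, P f ζ) :
    ∃ r, β ≤ r ∧ r < μ ∧ ∀ f : ℕ → Ordinal.{0}, (∀ n, f n < β) → ∃ ζ < r, P f ζ := by
  let e : β.ToType ≃o Iio β := Ordinal.ToType.mk.symm
  have h' : ∀ f : ℕ → β.ToType, ∃ ζ < μ, P (fun n => (e (f n)).1) ζ :=
    fun f => h _ fun n => (e (f n)).2
  choose z hz hP using h'
  have hcard : #(ℕ → β.ToType) < μ.cof := by simpa using hcof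
  refine ⟨max β (⨆ f, z f + 1), le_max_left _ _, max_lt hβ
    (Ordinal.iSup_add_one_lt_of_lt_cof hcard hz), fun f hf => ?_⟩
  refine ⟨z fun n => e.symm ⟨f n, hf n⟩, ?_, by simpa using hP fun n => e.symm ⟨f n, hf n⟩⟩
  refine lt_of_lt_of_le ?_ (le_max_right _ _)
  exact (Order.lt_succ _).trans_le (Ordinal.le_iSup (fun f => z f + 1) _)

/-- The cardinality of an order type. -/
theorem card_otp (s : Set Ordinal.{0}) : (otp s).card = #s := Ordinal.card_type _

namespace OModel

variable {κ : Cardinal.{0}}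

theorem κM_lt (A : OModel κ) : A.κM < κ.ord := by
  by_contra! h
  have : Cardinal.lift.{1} κ ≤ #A.M := by
    calc Cardinal.lift.{1} κ = #(Iio κ.ord) := by simp [Cardinal.mk_Iio_ordinal]
      _ ≤ #A.M := Cardinal.mk_le_mk_of_subset ((Iio_subset_Iio h).trans
        (A.inter ▸ inter_subset_left))
  exact this.not_gt A.card_lt

theorem mem_iff_lt (A : OModel κ) {x : Ordinal.{0}} (hx : x < κ.ord) : x ∈ A.M ↔ x < A.κM := by
  simpa [hx] using Set.ext_iff.1 A.inter x

theorem mem_of_lt (A : OModel κ) {x : Ordinal.{0}} (hx : x < A.κM) : x ∈ A.M :=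
  (A.mem_iff_lt (hx.trans A.κM_lt)).2 hx

theorem card_le (A : OModel κ) : #A.M ≤ Cardinal.lift.{1} (Order.succ A.κM.card) := by
  simpa [card_otp] using Ordinal.card_le_card A.otp_le

/-- Initial segments of a model below its elements outside `κ` are enumerated by `κM`. -/
theorem card_inter_Iio_le (A : OModel κ) {α : Ordinal.{0}} (hα : α ∈ A.M) (hκα : κ.ord ≤ α) :
    #(A.M ∩ Iio α : Set Ordinal.{0}) ≤ Cardinal.lift.{1} A.κM.card := by
  have : A.M ∩ Iio α ⊆ A.π α '' Iio A.κM := fun γ hγ => A.π_onto α hα hκα γ hγ.1 hγ.2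
  calc #(A.M ∩ Iio α : Set Ordinal.{0}) ≤ #(A.π α '' Iio A.κM) := Cardinal.mk_le_mk_of_subset this
    _ ≤ #(Iio A.κM) := Cardinal.mk_image_le
    _ = _ := Cardinal.mk_Iio_ordinal _

/-- A submodel of `N` contained in the submodel `A` of `N` is a submodel of `A`. -/
theorem submodel_of_subset {a A N : OModel κ} (ha : Submodel a N) (hA : Submodel A N)
    (h : a.M ⊆ A.M) : Submodel a A := by
  have hle : a.κM ≤ A.κM := by
    by_contra! hlt
    have := h (a.mem_of_lt hlt)
    exact lt_irrefl _ ((A.mem_iff_lt A.κM_lt).1 this)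
  refine ⟨h, fun α hα hκα β hβ hβα => ?_, fun α hα hκα β hβ => ?_⟩
  · rw [ha.2.1 α hα hκα β hβ hβα, hA.2.1 α (h hα) hκα β (h hβ) hβα]
  · rw [ha.2.2 α hα hκα β hβ, hA.2.2 α (h hα) hκα β (hβ.trans_le hle)]

/-- If `a` is a submodel of `N` with `κ_a ≤ κ_A`, then below any common element outside `κ`
it is contained in the submodel `A` of `N`. -/
theorem inter_Iio_subset {a A N : OModel κ} (ha : Submodel a N) (hA : Submodel A N)
    (hle : a.κM ≤ A.κM) {α : Ordinal.{0}} (hα : α ∈ a.M) (hαA : α ∈ A.M) (hκα : κ.ord ≤ α) :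
    a.M ∩ Iio α ⊆ A.M := by
  rintro γ ⟨hγ, hγα⟩
  obtain ⟨β, hβ, rfl⟩ := a.π_onto α hα hκα γ hγ hγα
  have hβα : β < α := (hβ.trans a.κM_lt).trans_le hκα
  have hβA := A.mem_of_lt (hβ.trans_le hle)
  rw [ha.2.1 α hα hκα β (a.mem_of_lt hβ) hβα, ← hA.2.1 α hαA hκα β hβA hβα]
  exact (A.π_mem α hαA hκα β hβA hβα).1

/-- A submodel in `E₁` of a union of two submodels with the same `κ_M` is contained in one
of the two. -/
theorem subset_or_subset_of_mem_E1 {a A B N : OModel κ} (ha : Submodel a N) (hA : Submodel A N)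
    (hB : Submodel B N) (hAB : A.κM = B.κM)
    (hN : ∀ α ∈ N.M, κ.ord ≤ α → α ∈ A.M ∪ B.M) (hE : a.M ∈ E1 κ) :
    a.M ⊆ A.M ∨ a.M ⊆ B.M := by
  obtain ⟨-, δ, hδ, hin, hotp⟩ := hE
  obtain rfl : a.κM = δ := Iio_injective (a.inter.symm.trans hδ)
  have hinf : ℵ₀ ≤ Cardinal.lift.{1} a.κM.card := by
    exact Cardinal.aleph0_le_lift.2 hin.2.aleph0_lt.le
  have hcard : #a.M = Order.succ (Cardinal.lift.{1} a.κM.card) := by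
    rw [← card_otp, hotp, succOrd]
    simp
  have hle : a.κM ≤ A.κM := by
    by_contra! hlt
    have hcl : Order.succ A.κM.card ≤ a.κM.card := by
      rw [Order.succ_le_iff, ← Cardinal.lt_ord, hin.1]
      exact hlt
    have hsub : a.M ⊆ Iio a.κM ∪ (A.M ∪ B.M) := fun x hx => by
      rcases lt_or_ge x κ.ord with h | h
      · exact Or.inl ((a.mem_iff_lt h).1 hx)
      · exact Or.inr (hN x (ha.1 hx) h)
    have hA' := A.card_le.trans (Cardinal.lift_le.{1}.2 hcl)
    have hB' := B.card_le.trans (Cardinal.lift_le.{1}.2 (hAB ▸ hcl))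
    have : #a.M ≤ Cardinal.lift.{1} a.κM.card :=
      (Cardinal.mk_le_mk_of_subset hsub).trans <| (Cardinal.mk_union_le _ _).trans <|
        Cardinal.add_le_of_le hinf (Cardinal.mk_Iio_ordinal _).le <|
          (Cardinal.mk_union_le _ _).trans (Cardinal.add_le_of_le hinf hA' hB')
    rw [hcard] at this
    exact (Order.lt_succ _).not_ge this
  have hunb : ∀ x ∈ a.M, κ.ord ≤ x → ∃ z ∈ a.M, x < z := fun x hx hκx => by
    by_contra! h
    have hsub : a.M ⊆ (a.M ∩ Iio x) ∪ {x} := fun z hz =>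
      (h z hz).lt_or_eq.imp (fun hzx => ⟨hz, hzx⟩) id
    have : #a.M ≤ Cardinal.lift.{1} a.κM.card :=
      (Cardinal.mk_le_mk_of_subset hsub).trans <| (Cardinal.mk_union_le _ _).trans <|
        Cardinal.add_le_of_le hinf (a.card_inter_Iio_le hx hκx)
          (by simpa using Cardinal.one_le_aleph0.trans hinf)
    rw [hcard] at this
    exact (Order.lt_succ _).not_ge this
  by_contra! h
  obtain ⟨⟨x, hx, hxA⟩, ⟨y, hy, hyB⟩⟩ := h.imp not_subset.1 not_subset.1
  have hκx : κ.ord ≤ x := by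
    by_contra! hlt
    exact hxA (A.mem_of_lt (((a.mem_iff_lt hlt).1 hx).trans_le hle))
  have hκy : κ.ord ≤ y := by
    by_contra! hlt
    exact hyB (B.mem_of_lt (((a.mem_iff_lt hlt).1 hy).trans_le (hle.trans_eq hAB)))
  obtain ⟨z, hz, hxz, hyz⟩ : ∃ z ∈ a.M, x < z ∧ y < z := by
    rcases le_total x y with hxy | hxy
    · obtain ⟨z, hz, h⟩ := hunb y hy hκy
      exact ⟨z, hz, hxy.trans_lt h, h⟩
    · obtain ⟨z, hz, h⟩ := hunb x hx hκx
      exact ⟨z, hz, h, hxy.trans_lt h⟩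
  have hκz := hκx.trans hxz.le
  rcases hN z (ha.1 hz) hκz with hzA | hzB
  · exact hxA (inter_Iio_subset ha hA hle hz hzA hκz ⟨hx, hxz⟩)
  · exact hyB (inter_Iio_subset ha hB (hle.trans_eq hAB) hz hzB hκz ⟨hy, hyz⟩)

/-- The functions `π_α` of two coherent models extend to a common function on a larger set
`N`, mapping `N ∩ κ = μ` onto `N ∩ α`. -/
theorem exists_common_π {A B : OModel κ} (hAB : A.κM = B.κM) (hcoh : Coherent A B)
    {μ : Ordinal.{0}} (hμκ : μ < κ.ord) {N : Set Ordinal.{0}}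
    (hAN : A.M ⊆ N) (hBN : B.M ⊆ N) (h0 : 0 ∈ N)
    (hcard : #N ≤ #(Ico A.κM μ)) (α : Ordinal.{0}) (hκα : κ.ord ≤ α) :
    ∃ p : Ordinal.{0} → Ordinal.{0},
      (α ∈ A.M → ∀ β ∈ A.M, β < α → A.π α β = p β) ∧
      (α ∈ B.M → ∀ β ∈ B.M, β < α → B.π α β = p β) ∧
      (∀ β ∈ N, β < α → p β ∈ N ∧ p β < α) ∧
      ∀ γ ∈ N, γ < α → ∃ β < μ, p β = γ := by
  classical
  have h0α : 0 < α := (bot_le.trans_lt hμκ).trans_le hκα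
  obtain ⟨⟨j, hj⟩⟩ := hcard
  let e : Ordinal.{0} → Ordinal.{0} := fun β =>
    if h : ∃ γ : N, γ.1 < α ∧ (j γ).1 = β then h.choose.1 else 0
  have he : ∀ β, e β ∈ N ∧ e β < α := fun β => by
    by_cases h : ∃ γ : N, γ.1 < α ∧ (j γ).1 = β
    · simp only [e, dif_pos h]
      exact ⟨h.choose.2, h.choose_spec.1⟩
    · simp only [e, dif_neg h]
      exact ⟨h0, h0α⟩
  have hej : ∀ γ : N, γ.1 < α → e (j γ) = γ := fun γ hγ => by
    have h : ∃ γ' : N, γ'.1 < α ∧ (j γ').1 = j γ := ⟨γ, hγ, rfl⟩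
    simp only [e, dif_pos h]
    exact congrArg Subtype.val (hj (Subtype.ext h.choose_spec.2))
  refine ⟨fun β => if α ∈ A.M ∧ β ∈ A.M then A.π α β else
    if α ∈ B.M ∧ β ∈ B.M then B.π α β else e β, fun hα β hβ hβα => ?_,
    fun hα β hβ hβα => ?_, fun β hβ hβα => ?_, fun γ hγ hγα => ?_⟩
  · exact (if_pos ⟨hα, hβ⟩).symm
  · dsimp only
    split_ifs with h
    · exact (hcoh.1 α ⟨h.1, hα⟩ hκα β ⟨h.2, hβ⟩ hβα).symm
    · rfl
    · exact absurd (And.intro hα hβ) ‹_›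
  · dsimp only
    split_ifs with h h'
    · exact (A.π_mem α h.1 hκα β h.2 hβα).imp_left (@hAN _)
    · exact (B.π_mem α h'.1 hκα β h'.2 hβα).imp_left (@hBN _)
    · exact he β
  · have hjγ := (j ⟨γ, hγ⟩).2
    have hjκ := hjγ.2.trans hμκ
    refine ⟨j ⟨γ, hγ⟩, hjγ.2, ?_⟩
    dsimp only
    rw [if_neg fun h => ((A.mem_iff_lt hjκ).1 h.2).not_ge hjγ.1,
      if_neg fun h => ((B.mem_iff_lt hjκ).1 h.2).not_ge (hAB ▸ hjγ.1), hej _ hγα]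

/-- One coordinate of the extension of the function `ρ` to a common extension of two
coherent conditions. -/
theorem exists_common_ρ {S : Set (Set Ordinal.{0})} {A B : OModel κ}
    (h₁ : IsCondition κ S A) (h₂ : IsCondition κ S B) (hAB : A.κM = B.κM)
    (hcoh : Coherent A B) {μ : Ordinal.{0}}
    (hcof : ∀ β < μ, β.card ^ ℵ₀ < μ.cof) (hlt : A.κM < μ) (hμκ : μ < κ.ord) {N : Set Ordinal.{0}}
    (hN : ∀ γ : Ordinal.{0}, γ.cof = ℵ₀ → sSup (N ∩ Iio γ) = γ → γ ∈ N)
    (hμN : Iio μ ⊆ N) {α : Ordinal.{0}} (hα : α ∈ A.M ∪ B.M)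
    (hκα : κ.ord ≤ α) {p : Ordinal.{0} → Ordinal.{0}}
    (hpA : α ∈ A.M → ∀ β ∈ A.M, β < α → A.π α β = p β)
    (hpB : α ∈ B.M → ∀ β ∈ B.M, β < α → B.π α β = p β)
    (hp : ∀ β ∈ N, β < α → p β ∈ N ∧ p β < α)
    (hp' : ∀ γ ∈ N, γ < α → ∃ β < μ, p β = γ)
    (β : Ordinal.{0}) (hβ : β < μ) :
    ∃ r, (α ∈ A.M → β < A.κM → A.ρ α β = r) ∧ (α ∈ B.M → β < B.κM → B.ρ α β = r) ∧
      β ≤ r ∧ r < μ ∧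
      ∀ f : ℕ → Ordinal.{0}, (∀ n, f n < β) → μ ≤ ⨆ n, p (f n) →
        (⨆ n, p (f n)) < α → ∃ ζ < r, (⨆ n, p (f n)) = p ζ := by
  have key (C : OModel κ) (hC : IsCondition κ S C) (hαC : α ∈ C.M)
      (hpC : α ∈ C.M → ∀ β ∈ C.M, β < α → C.π α β = p β) (hβC : β < C.κM)
      (hCμ : C.κM < μ) :
      β ≤ C.ρ α β ∧ C.ρ α β < μ ∧
      ∀ f : ℕ → Ordinal.{0}, (∀ n, f n < β) → μ ≤ ⨆ n, p (f n) →
        (⨆ n, p (f n)) < α → ∃ ζ < C.ρ α β, (⨆ n, p (f n)) = p ζ := by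
    have hpC' : ∀ ξ < C.κM, C.π α ξ = p ξ := fun ξ hξ =>
      hpC hαC ξ (C.mem_of_lt hξ) ((hξ.trans C.κM_lt).trans_le hκα)
    have hρ := C.ρ_spec α hαC hκα β hβC
    refine ⟨hρ.1, hρ.2.trans hCμ, fun f hf hμ hlt => ?_⟩
    obtain ⟨ζ, hζ, h⟩ := hC.sup_prop α hαC hκα β hβC _ (hCμ.le.trans hμ) hlt f hf
      (by simp only [hpC' _ ((hf _).trans hβC)])
    exact ⟨ζ, hζ, h.trans (hpC' ζ (hζ.trans hρ.2))⟩
  rcases lt_or_ge β A.κM with hβA | hβA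
  · by_cases hαA : α ∈ A.M
    · exact ⟨A.ρ α β, fun _ _ => rfl,
        fun hαB hβB => (hcoh.2 α ⟨hαA, hαB⟩ hκα β hβA hβB).symm, key A h₁ hαA hpA hβA hlt⟩
    · have hαB := hα.resolve_left hαA
      exact ⟨B.ρ α β, fun h => absurd h hαA, fun _ _ => rfl,
        key B h₂ hαB hpB (hAB ▸ hβA) (hAB ▸ hlt)⟩
  · have hw : ∀ f : ℕ → Ordinal.{0}, (∀ n, f n < β) → ∃ ζ < μ,
        (⨆ n, p (f n)) < α → (⨆ n, p (f n)) = p ζ := fun f hf => by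
      by_cases hs : (⨆ n, p (f n)) < α
      · have hmem : (⨆ n, p (f n)) ∈ N := iSup_mem_of_omega_closed hN _ fun n =>
          (hp _ (hμN ((hf n).trans hβ)) ((((hf n).trans hβ).trans hμκ).trans_le hκα)).1
        obtain ⟨ζ, hζ, h⟩ := hp' _ hmem hs
        exact ⟨ζ, hζ, fun _ => h.symm⟩
      · exact ⟨0, bot_le.trans_lt hlt, fun h => absurd h hs⟩
    obtain ⟨r, hβr, hrμ, hr⟩ := exists_index_bound hβ (hcof β hβ) hw
    refine ⟨r, fun _ h => absurd h hβA.not_gt, fun _ h => absurd h (hAB ▸ hβA).not_gt, hβr, hrμ,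
      fun f hf _ hs => ?_⟩
    obtain ⟨ζ, hζ, h⟩ := hr f hf
    exact ⟨ζ, hζ, h hs⟩

end OModel

/-- Lemma 3.10: two coherent conditions in `Q(S)` with the same `κ_M` are
compatible. -/
theorem stmt4 (κ : Cardinal.{0}) (hκ : κ.IsInaccessible)
    (S : Set (Set Ordinal.{0})) (hS0 : S ⊆ E0 κ)
    (hSstat : IsStationary κ (Iio (succOrd κ)) S)
    (M₁ M₂ : OModel κ) (h₁ : IsCondition κ S M₁) (h₂ : IsCondition κ S M₂)
    (hκM : M₁.κM = M₂.κM) (hcoh : Coherent M₁ M₂) :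
    ∃ N : OModel κ, IsCondition κ S N ∧ Stronger N M₁ ∧ Stronger N M₂ := by
  obtain ⟨c₁, hc₁⟩ := Cardinal.mem_range_lift_of_le M₁.card_lt.le
  obtain ⟨c₂, hc₂⟩ := Cardinal.mem_range_lift_of_le M₂.card_lt.le
  have hc₁κ : c₁ < κ := Cardinal.lift_lt.{0, 1}.1 (hc₁ ▸ M₁.card_lt)
  have hc₂κ : c₂ < κ := Cardinal.lift_lt.{0, 1}.1 (hc₂ ▸ M₂.card_lt)
  let c : Cardinal.{0} := max ℵ₀ (max c₁ c₂)
  have hc : ℵ₀ ≤ c := le_max_left _ _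
  have hc₁c : c₁ ≤ c := (le_max_left _ _).trans (le_max_right _ _)
  have hc₂c : c₂ ≤ c := (le_max_right _ _).trans (le_max_right _ _)
  have hcκ : c < κ := max_lt hκ.aleph0_lt (max_lt hc₁κ hc₂κ)
  let ν : Cardinal.{0} := Order.succ ((2 : Cardinal) ^ c)
  have hνκ : ν < κ := hκ.isSuccLimit.succ_lt (hκ.isStrongLimit.isStrongPrelimit hcκ)
  have hcν : c < ν := (Cardinal.cantor c).trans (Order.lt_succ _)
  have hℵν : ℵ₀ < ν := hc.trans_lt hcν
  have hμκ : ν.ord < κ.ord := Cardinal.ord_lt_ord.2 hνκ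
  have hκM₁c : M₁.κM.card ≤ c := by
    rw [← Cardinal.lift_le.{1}, ← Cardinal.mk_Iio_ordinal]
    exact (Cardinal.mk_le_mk_of_subset fun _ h => M₁.mem_of_lt h).trans
      (hc₁ ▸ Cardinal.lift_le.2 hc₁c)
  have hθμ : M₁.κM < ν.ord := Cardinal.lt_ord.2 (hκM₁c.trans_lt hcν)
  let N : Set Ordinal.{0} := M₁.M ∪ M₂.M ∪ Iio ν.ord
  have hAN : M₁.M ⊆ N := subset_union_left.trans subset_union_left
  have hBN : M₂.M ⊆ N := subset_union_right.trans subset_union_left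
  have hμN : Iio ν.ord ⊆ N := subset_union_right
  have hNκ : ∀ α ∈ N, κ.ord ≤ α → α ∈ M₁.M ∪ M₂.M := fun α hα hκα =>
    hα.resolve_right fun h => (hμκ.trans_le hκα).not_gt h
  have hℵl : ℵ₀ ≤ Cardinal.lift.{1} ν := Cardinal.aleph0_le_lift.2 hℵν.le
  have hNcard : #N ≤ Cardinal.lift.{1} ν := by
    refine (Cardinal.mk_union_le _ _).trans (Cardinal.add_le_of_le hℵl
      ((Cardinal.mk_union_le _ _).trans (Cardinal.add_le_of_le hℵl ?_ ?_)) ?_)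
    · exact hc₁ ▸ Cardinal.lift_le.2 (hc₁c.trans hcν.le)
    · exact hc₂ ▸ Cardinal.lift_le.2 (hc₂c.trans hcν.le)
    · simp [Cardinal.mk_Iio_ordinal]
  have hIco : Cardinal.lift.{1} ν ≤ #(Ico M₁.κM ν.ord) := by
    by_contra! h
    have hsub : Iio ν.ord ⊆ Iio M₁.κM ∪ Ico M₁.κM ν.ord := fun x hx =>
      (lt_or_ge x M₁.κM).imp id fun h => ⟨h, hx⟩
    have h' : Cardinal.lift.{1} M₁.κM.card < Cardinal.lift.{1} ν :=
      Cardinal.lift_lt.2 (hκM₁c.trans_lt hcν)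
    have := (Cardinal.mk_le_mk_of_subset hsub).trans (Cardinal.mk_union_le _ _)
    rw [Cardinal.mk_Iio_ordinal, Cardinal.mk_Iio_ordinal, Cardinal.card_ord] at this
    exact this.not_gt (Cardinal.add_lt_of_lt hℵl h' h)
  have hν : ν.ord.cof = ν := (Cardinal.isRegular_succ (hc.trans (Cardinal.cantor c).le)).cof_ord
  have hcof : ∀ β < ν.ord, β.card ^ ℵ₀ < ν.ord.cof := fun β hβ => by
    rw [hν, Order.lt_succ_iff]
    calc β.card ^ ℵ₀ ≤ (2 ^ c) ^ ℵ₀ :=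
          Cardinal.power_le_power_right (Order.lt_succ_iff.1 (Cardinal.lt_ord.1 hβ))
      _ = 2 ^ c := by rw [← Cardinal.power_mul, Cardinal.mul_aleph0_eq hc]
  have hNω := omega_closed_union (hν.trans_ne hℵν.ne')
    h₁.omega_closed h₂.omega_closed
  have hπ := OModel.exists_common_π hκM hcoh hμκ hAN hBN
    (hμN (bot_le.trans_lt hθμ)) (hNcard.trans hIco)
  choose! π hπ₁ hπ₂ hπ_mem hπ_onto using hπ
  have hρ : ∀ α ∈ M₁.M ∪ M₂.M, κ.ord ≤ α → _ := fun α hα hκα =>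
    OModel.exists_common_ρ h₁ h₂ hκM hcoh hcof hθμ hμκ hNω hμN hα hκα (hπ₁ α hκα) (hπ₂ α hκα)
      (hπ_mem α hκα) (hπ_onto α hκα)
  choose! ρ hρ₁ hρ₂ hρ_le hρ_lt hρ_sup using hρ
  let K : OModel κ :=
    { M := N
      κM := ν.ord
      π := π
      ρ := ρ
      sub := union_subset (union_subset M₁.sub M₂.sub) fun x hx =>
        lt_trans hx (hμκ.trans (Cardinal.ord_lt_ord.2 (Order.lt_succ κ)))
      card_lt := hNcard.trans_lt (Cardinal.lift_lt.2 hνκ)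
      inter := by
        ext x
        simp only [N, mem_inter_iff, mem_union, mem_Iio]
        constructor
        · rintro ⟨(hx | hx) | hx, hxκ⟩
          · exact ((M₁.mem_iff_lt hxκ).1 hx).trans hθμ
          · exact ((M₂.mem_iff_lt hxκ).1 hx).trans (hκM ▸ hθμ)
          · exact hx
        · exact fun hx => ⟨Or.inr hx, hx.trans hμκ⟩
      otp_le := by
        rw [Cardinal.card_ord, Cardinal.lift_ord, Cardinal.lift_succ]
        refine (Cardinal.lt_ord.2 ?_).le
        rw [card_otp]
        exact Order.lt_succ_of_le hNcard
      π_mem := fun α _ hκα => hπ_mem α hκα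
      π_onto := fun α _ hκα => hπ_onto α hκα
      ρ_spec := fun α hα hκα β hβ =>
        ⟨hρ_le α (hNκ α hα hκα) hκα β hβ, hρ_lt α (hNκ α hα hκα) hκα β hβ⟩ }
  have hK₁ : Submodel M₁ K := ⟨hAN, fun α hα hκα => hπ₁ α hκα hα,
    fun α hα hκα β hβ => hρ₁ α (Or.inl hα) hκα β (hβ.trans hθμ) hα hβ⟩
  have hK₂ : Submodel M₂ K := ⟨hBN, fun α hα hκα => hπ₂ α hκα hα,
    fun α hα hκα β hβ => hρ₂ α (Or.inr hα) hκα β (hβ.trans (hκM ▸ hθμ)) hα hβ⟩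
  refine ⟨K, ⟨hNω, ?_, fun a ha hE => ?_⟩, ⟨hK₁, ?_⟩, ⟨hK₂, ?_⟩⟩
  · rintro α hα hκα β hβ γ hγ hγα f hf rfl
    exact hρ_sup α (hNκ α hα hκα) hκα β hβ f hf hγ hγα
  · rcases OModel.subset_or_subset_of_mem_E1 ha hK₁ hK₂ hκM hNκ hE with h | h
    · exact h₁.reflect a (OModel.submodel_of_subset ha hK₁ h) hE
    · exact h₂.reflect a (OModel.submodel_of_subset ha hK₂ h) hE
  · rw [← hc₁, Cardinal.lift_lt, Cardinal.card_ord]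
    exact hc₁c.trans_lt hcν
  · rw [← hc₂, Cardinal.lift_lt, Cardinal.card_ord]
    exact hc₂c.trans_lt hcν

end PKL
end

section
/- Let ⟨M_n : n < ω⟩ be a sequence of models such that M_n is a submodel of M_{n+1} for every n, and let a be a model such that a ⊆ ⋃_{n<ω} M_n, a is coherent with each M_n, the cofinality of λ_a (the order type of a) is uncountable, and κ_a ≤ κ_{M_n} for all n ≥ n_0 for some n_0 < ω. Then a ⊆ M_n for some n < ω. -/
open Cardinal Set

namespace PKL

theorem OModel.mem_of_lt_s5 {κ : Cardinal.{0}} (A : OModel κ) {β : Ordinal.{0}} (h : β < A.κM) :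
    β ∈ A.M ∧ β < κ.ord := by
  have : β ∈ A.M ∩ Iio κ.ord := by rw [A.inter]; exact h
  exact this

/-- If every element of `a` is dominated by an element of `a` lying in `B`, and `κ_a ≤ κ_B`, then
coherence of `a` with `B` forces `a ⊆ B`. -/
theorem Coherent.subset_of_unbounded {κ : Cardinal.{0}} {a B : OModel κ} (h : Coherent a B)
    (hκ : a.κM ≤ B.κM) (hB : ∀ γ ∈ a.M, ∃ α ∈ a.M ∩ B.M, γ < α) : a.M ⊆ B.M := by
  intro γ hγ
  rcases lt_or_ge γ κ.ord with hlt | hge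
  · have hγ' : γ ∈ a.M ∩ Iio κ.ord := ⟨hγ, hlt⟩
    rw [a.inter] at hγ'
    exact (B.mem_of_lt_s5 (lt_of_lt_of_le hγ' hκ)).1
  · obtain ⟨α, hα, hγα⟩ := hB γ hγ
    have hκα : κ.ord ≤ α := hge.trans hγα.le
    obtain ⟨β, hβ, rfl⟩ := a.π_onto α hα.1 hκα γ hγ hγα
    have hβa := a.mem_of_lt_s5 hβ
    have hβB := B.mem_of_lt_s5 (hβ.trans_le hκ)
    have hβα := hβa.2.trans_le hκα
    rw [h.1 α hα hκα β ⟨hβa.1, hβB.1⟩ hβα]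
    exact (B.π_mem α hα.2 hκα β hβB.1 hβα).1

/-- If a set of ordinals whose order type has uncountable cofinality is covered by countably many
sets, then one of them is unbounded in it. -/
theorem exists_unbounded_of_subset_iUnion {s : Set Ordinal.{0}} (hs : ℵ₀ < (otp s).cof)
    {t : ℕ → Set Ordinal.{0}} (hst : s ⊆ ⋃ n, t n) :
    ∃ n, ∀ γ ∈ s, ∃ α ∈ s ∩ t n, γ < α := by
  by_contra! h
  choose g hgs hg using h
  have hcof : IsCofinal (Set.range fun n => (⟨g n, hgs n⟩ : s)) := by
    rintro ⟨γ, hγ⟩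
    obtain ⟨n, hn⟩ := Set.mem_iUnion.1 (hst hγ)
    exact ⟨_, ⟨n, rfl⟩, hg n γ ⟨hγ, hn⟩⟩
  refine hs.not_ge ?_
  rw [otp, Ordinal.cof_type]
  exact (Order.cof_le hcof).trans (Set.countable_range _).le_aleph0

/-- If `⟨Mₙ : n < ω⟩` is a `⊆`-increasing chain of models (each a submodel of
the next), and `a` is a model with `a ⊆ ⋃ₙ Mₙ`, coherent with each `Mₙ`, with
`cf(λ_a)` uncountable and `κ_a ≤ κ_{Mₙ}` for all `n ≥ n₀`, then `a ⊆ Mₙ` for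
some `n`. -/
theorem stmt5 (κ : Cardinal.{0}) (hreg : κ.IsRegular) (hunc : ℵ₀ < κ)
    (Ms : ℕ → OModel κ) (hsub : ∀ n, Submodel (Ms n) (Ms (n + 1)))
    (a : OModel κ) (ha : a.M ⊆ ⋃ n, (Ms n).M)
    (hcoh : ∀ n, Coherent a (Ms n))
    (hcf : ℵ₀ < (otp a.M).cof)
    (n₀ : ℕ) (hκa : ∀ n ≥ n₀, a.κM ≤ (Ms n).κM) :
    ∃ n, a.M ⊆ (Ms n).M := by
  have hmono : Monotone fun n => (Ms n).M := monotone_nat_of_le_succ fun n => (hsub n).1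
  have hcover : a.M ⊆ ⋃ n, (Ms (n + n₀)).M :=
    ha.trans (Set.iUnion_mono fun n => hmono (Nat.le_add_right n n₀))
  obtain ⟨n, hn⟩ := exists_unbounded_of_subset_iUnion hcf hcover
  exact ⟨n + n₀, (hcoh _).subset_of_unbounded (hκa _ (Nat.le_add_left n₀ n)) hn⟩

end PKL
end

section
/- Let (M, π^M, ρ^M) be a model that is ω-closed (for every ordinal γ, if cf(γ) = ω and sup(M ∩ γ) = γ then γ ∈ M) and satisfies: for every α ∈ M \ κ and β < κ_M, if κ_M ≤ γ < α and {β_n : n < ω} is a countable subset of β with γ = sup{π^M_α(β_n) : n < ω}, then γ = π^M_α(ζ) for some ζ < ρ^M_α(β). Let a be a submodel of M with cf(κ_a) > ω. Suppose ⟨γ_n : n < ω⟩ is a strictly increasing sequence of elements of a with κ ≤ γ_n for all n, let γ = sup_n γ_n, and suppose there exists α ∈ a with α > γ. Then γ ∈ a. -/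
open Cardinal Set

namespace PKL

/-- If `M` is an `ω`-closed model satisfying clause (ii) of Definition 3.3,
`a` is a submodel of `M` with `cf(κ_a) > ω`, `⟨γₙ⟩` is a strictly increasing
sequence of elements of `a` with `κ ≤ γₙ`, `γ = supₙ γₙ`, and some `α ∈ a`
satisfies `α > γ`, then `γ ∈ a`. -/
theorem stmt6 (κ : Cardinal.{0}) (hreg : κ.IsRegular) (hunc : ℵ₀ < κ)
    (M : OModel κ)
    (homega : ∀ γ : Ordinal.{0}, γ.cof = ℵ₀ → sSup (M.M ∩ Iio γ) = γ → γ ∈ M.M)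
    (hsup : ∀ α ∈ M.M, κ.ord ≤ α → ∀ β < M.κM, ∀ γ : Ordinal.{0},
      M.κM ≤ γ → γ < α →
      ∀ f : ℕ → Ordinal.{0}, (∀ n, f n < β) → γ = ⨆ n, M.π α (f n) →
      ∃ ζ < M.ρ α β, γ = M.π α ζ)
    (a : OModel κ) (hsub : Submodel a M) (hcf : ℵ₀ < a.κM.cof)
    (g : ℕ → Ordinal.{0}) (hg : StrictMono g) (hga : ∀ n, g n ∈ a.M)
    (hgκ : ∀ n, κ.ord ≤ g n)
    (γ : Ordinal.{0}) (hγ : γ = ⨆ n, g n)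
    (α : Ordinal.{0}) (hα : α ∈ a.M) (hαγ : γ < α) :
    γ ∈ a.M := by
  obtain ⟨hsubM, hπ, hρ⟩ := hsub
  have hgγ (n : ℕ) : g n ≤ γ := hγ ▸ Ordinal.le_iSup g n
  have hκγ : κ.ord ≤ γ := (hgκ 0).trans (hgγ 0)
  have hκα : κ.ord ≤ α := hκγ.trans hαγ.le
  have mem_of_lt {ξ : Ordinal.{0}} (hξ : ξ < a.κM) : ξ ∈ a.M ∧ ξ < κ.ord :=
    a.inter.ge hξ
  have hκa : a.κM ≤ M.κM := by
    rw [← Iio_subset_Iio_iff, ← a.inter, ← M.inter]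
    exact inter_subset_inter_left _ hsubM
  have hκM : M.κM ≤ κ.ord := by
    rw [← Iio_subset_Iio_iff, ← M.inter]
    exact inter_subset_right
  have hπM {ξ : Ordinal.{0}} (hξ : ξ < a.κM) : a.π α ξ = M.π α ξ :=
    hπ α hα hκα ξ (mem_of_lt hξ).1 ((mem_of_lt hξ).2.trans_le hκα)
  choose f hf hfg using fun n ↦ a.π_onto α hα hκα (g n) (hga n) ((hgγ n).trans_lt hαγ)
  have hβ : ⨆ n, f n + 1 < a.κM :=
    Ordinal.iSup_add_one_lt_of_lt_cof (by simpa using hcf) hf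
  have hfβ (n : ℕ) : f n < ⨆ n, f n + 1 :=
    (lt_add_one (f n)).trans_le (Ordinal.le_iSup (fun n ↦ f n + 1) n)
  have hγf : γ = ⨆ n, M.π α (f n) := by
    simp_rw [hγ, ← hπM (hf _), hfg]
  obtain ⟨ζ, hζ, rfl⟩ := hsup α (hsubM hα) hκα _ (hβ.trans_le hκa) γ
    (hκM.trans hκγ) hαγ f hfβ hγf
  have hζa : ζ < a.κM := by
    rw [← hρ α hα hκα _ hβ] at hζ
    exact hζ.trans (a.ρ_spec α hα hκα _ hβ).2
  obtain ⟨hζM, hζκ⟩ := mem_of_lt hζa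
  rw [← hπM hζa]
  exact (a.π_mem α hα hκα ζ hζM (hζκ.trans_le hκα)).1

end PKL
end

section
/- Let κ be a regular uncountable cardinal, let λ > κ be a cardinal, and let S and T be sets of ordinals below λ such that every α ∈ S has cofinality ω, every γ ∈ T has cofinality ω₁, and for each γ ∈ T the set S ∩ γ is nonstationary in γ. Let Ŝ = {x ∈ 𝒫_κ λ : sup x ∈ S} and T̂ = {a ∈ 𝒫_κ λ : sup a ∈ T}. Then Ŝ does not reflect at any a ∈ T̂: for every a ∈ T̂ such that κ_a = a ∩ κ is a regular uncountable cardinal, the set Ŝ ∩ 𝒫_{κ_a} a is nonstationary in 𝒫_{κ_a} a. -/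
open Cardinal Set

namespace PKL

/-- `C` is a closed unbounded subset of the ordinal `γ`. -/
def IsClubIn (C : Set Ordinal.{0}) (γ : Ordinal.{0}) : Prop :=
  C ⊆ Iio γ ∧ (∀ β < γ, ∃ ξ ∈ C, β ≤ ξ) ∧
  ∀ δ < γ, 0 < δ → sSup (C ∩ Iio δ) = δ → δ ∈ C

theorem IsClubIn.mem_of_limit {C : Set Ordinal.{0}} {γ η : Ordinal.{0}} (hC : IsClubIn C γ)
    (hη : η < γ) (h0 : 0 < η) (h : ∀ ξ < η, ∃ c ∈ C, ξ < c ∧ c < η) : η ∈ C := by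
  refine hC.2.2 η hη h0 (le_antisymm (csSup_le' fun c hc => hc.2.le) ?_)
  by_contra! hlt
  obtain ⟨c, hcC, hc, hcη⟩ := h _ hlt
  exact hc.not_ge (le_csSup ⟨η, fun d hd => hd.2.le⟩ ⟨hcC, hcη⟩)

/-- The subsets of `a` whose supremum lies in a club of `sSup a`, or equals `sSup a`, form a club
in `𝒫_μ a`. -/
theorem isClub_setOf_sSup_mem {μ : Cardinal.{0}} (hμ : μ.IsRegular) (hunc : ℵ₀ < μ)
    {a C : Set Ordinal.{0}} (ha : BddAbove a) (hcof : ℵ₀ < (sSup a).cof)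
    (hC : IsClubIn C (sSup a)) :
    IsClub μ a {x | x ∈ PSet μ a ∧ (sSup x ∈ C ∨ sSup x = sSup a)} := by
  have hreg : (Cardinal.lift.{1} μ).IsRegular := hμ.lift
  have hℵ : ℵ₀ < Cardinal.lift.{1} μ := by simpa using hunc
  refine ⟨fun x hx => hx.1, ?_, ?_⟩
  · rintro x ⟨hxa, hxμ⟩
    have hle : sSup x ≤ sSup a := csSup_le' fun ξ hξ => le_csSup ha (hxa hξ)
    by_cases hγ : sSup a ∈ a
    · have hsub : x ∪ {sSup a} ⊆ a := union_subset hxa (singleton_subset_iff.2 hγ)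
      refine ⟨x ∪ {sSup a}, ⟨⟨hsub, ?_⟩, .inr ?_⟩, subset_union_left⟩
      · refine (mk_union_le _ _).trans_lt (add_lt_of_lt hreg.aleph0_le hxμ ?_)
        simpa using one_lt_aleph0.trans hℵ
      · exact le_antisymm (csSup_le' fun ξ hξ => le_csSup ha (hsub hξ))
          (le_csSup (ha.mono hsub) (.inr rfl))
    rcases hle.eq_or_lt with heq | hlt
    · exact ⟨x, ⟨⟨hxa, hxμ⟩, .inr heq⟩, Subset.rfl⟩
    have hg : ∀ ξ < sSup a, ∃ ζ ∈ a, ξ < ζ := fun ξ hξ => (lt_csSup_iff' ha).1 hξ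
    choose! g hga hg using hg
    have hgγ : ∀ ξ < sSup a, g ξ < sSup a := fun ξ hξ =>
      (le_csSup ha (hga ξ hξ)).lt_of_ne fun h => hγ (h ▸ hga ξ hξ)
    choose! c hcC hc using hC.2.1
    have hcγ : ∀ ξ < sSup a, c ξ < sSup a := fun ξ hξ => hC.1 (hcC ξ hξ)
    let s : ℕ → Ordinal.{0} := fun n => (fun ξ => g (c ξ))^[n] (g (sSup x))
    have hs_succ (n : ℕ) : s (n + 1) = g (c (s n)) := Function.iterate_succ_apply' _ _ _
    have hsγ (n : ℕ) : s n < sSup a := by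
      induction n with
      | zero => exact hgγ _ hlt
      | succ n ih => rw [hs_succ]; exact hgγ _ (hcγ _ ih)
    have hsa (n : ℕ) : s n ∈ a := by
      cases n with
      | zero => exact hga _ hlt
      | succ n => rw [hs_succ]; exact hga _ (hcγ _ (hsγ n))
    have hcs (n : ℕ) : c (s n) < s (n + 1) := by
      rw [hs_succ]; exact hg _ (hcγ _ (hsγ n))
    have hsub : x ∪ range s ⊆ a := union_subset hxa (range_subset_iff.2 hsa)
    have hbdd : BddAbove (range s) := ha.mono (range_subset_iff.2 hsa)
    have hsup : sSup (x ∪ range s) = ⨆ n, s n := by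
      refine le_antisymm (csSup_le' ?_) (ciSup_le' fun n =>
        le_csSup (ha.mono hsub) (.inr ⟨n, rfl⟩))
      rintro ξ (hξ | ⟨n, rfl⟩)
      · exact ((le_csSup (ha.mono hxa) hξ).trans (hg _ hlt).le).trans (le_ciSup hbdd 0)
      · exact le_ciSup hbdd n
    refine ⟨x ∪ range s, ⟨⟨hsub, ?_⟩, .inl ?_⟩, subset_union_left⟩
    · exact (mk_union_le _ _).trans_lt (add_lt_of_lt hreg.aleph0_le hxμ
        ((countable_range s).le_aleph0.trans_lt hℵ))
    · rw [hsup]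
      have hcη (n : ℕ) : c (s n) < ⨆ n, s n := (hcs n).trans_le (le_ciSup hbdd (n + 1))
      refine hC.mem_of_limit (Ordinal.iSup_lt_of_lt_cof (by simpa using hcof) hsγ)
        (zero_le.trans_lt (hcη 0)) fun ξ hξ => ?_
      obtain ⟨n, hn⟩ := (lt_ciSup_iff' hbdd).1 hξ
      exact ⟨c (s n), hcC _ (hsγ n), hn.trans_le (hc _ (hsγ n)), hcη n⟩
  · intro δ hδ0 hδ f _ hf
    have hsub : (⋃ α ∈ Iio δ, f α) ⊆ a := iUnion₂_subset fun α hα => (hf α hα).1.1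
    have hle {α : Ordinal.{0}} (hα : α < δ) : sSup (f α) ≤ sSup (⋃ α ∈ Iio δ, f α) :=
      csSup_le' fun ξ hξ => le_csSup (ha.mono hsub) (mem_biUnion (mem_Iio.2 hα) hξ)
    have hleγ : sSup (⋃ α ∈ Iio δ, f α) ≤ sSup a :=
      csSup_le' fun ξ hξ => le_csSup ha (hsub hξ)
    refine ⟨⟨hsub, ?_⟩, ?_⟩
    · refine (card_biUnion_lt_iff_forall_of_isRegular hreg ?_).2 fun α hα => (hf α hα).1.2
      rw [mk_Iio_ordinal, Cardinal.lift_lt]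
      exact lt_ord.1 hδ
    by_cases hatt : ∃ α < δ, sSup (f α) = sSup (⋃ α ∈ Iio δ, f α)
    · obtain ⟨α, hα, h⟩ := hatt
      exact h ▸ (hf α hα).2
    push Not at hatt
    have hlt {α : Ordinal.{0}} (hα : α < δ) := (hle hα).lt_of_ne (hatt α hα)
    rcases hleγ.eq_or_lt with heq | hltγ
    · exact .inr heq
    refine .inl (hC.mem_of_limit hltγ (zero_le.trans_lt (hlt hδ0)) fun ξ hξ => ?_)
    obtain ⟨ζ, hζ, hξζ⟩ := (lt_csSup_iff' (ha.mono hsub)).1 hξ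
    obtain ⟨α, hα, hζα⟩ := mem_iUnion₂.1 hζ
    refine ⟨sSup (f α), (hf α hα).2.resolve_right ((hlt hα).trans_le hleγ).ne,
      hξζ.trans_le (le_csSup (ha.mono (hf α hα).1.1) hζα), hlt hα⟩

/-- If every `α ∈ S` has cofinality `ω`, every `γ ∈ T` has cofinality `ω₁`,
and `S ∩ γ` is nonstationary in `γ` for each `γ ∈ T`, then
`Ŝ = {x ∈ 𝒫_κ λ : sup x ∈ S}` does not reflect at any `a ∈ T̂`. -/
theorem stmt7 (κ lam : Cardinal.{0}) (hreg : κ.IsRegular) (hunc : ℵ₀ < κ)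
    (hlam : κ < lam)
    (S T : Set Ordinal.{0}) (hS : S ⊆ Iio lam.ord) (hT : T ⊆ Iio lam.ord)
    (hScof : ∀ α ∈ S, α.cof = ℵ₀) (hTcof : ∀ γ ∈ T, γ.cof = aleph 1)
    (hTns : ∀ γ ∈ T, ∃ C, IsClubIn C γ ∧ C ∩ S = ∅)
    (a : Set Ordinal.{0}) (ha : a ∈ PSet κ (Iio lam.ord)) (haT : sSup a ∈ T)
    (κa : Ordinal.{0}) (hκa : a ∩ Iio κ.ord = Iio κa)
    (hκacard : κa.card.ord = κa) (hκareg : κa.card.IsRegular)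
    (hκaunc : ℵ₀ < κa.card) :
    ¬ IsStationary κa.card a
        ({x | x ∈ PSet κ (Iio lam.ord) ∧ sSup x ∈ S} ∩ PSet κa.card a) := by
  intro hstat
  obtain ⟨C, hC, hCS⟩ := hTns _ haT
  have hcof : ℵ₀ < (sSup a).cof := hTcof _ haT ▸ aleph0_lt_aleph_one
  have hbdd : BddAbove a := ⟨lam.ord, fun ξ hξ => (ha.1 hξ).le⟩
  obtain ⟨x, ⟨⟨-, hxS⟩, -⟩, -, hxC | hx⟩ :=
    hstat _ (isClub_setOf_sSup_mem hκareg hκaunc hbdd hcof hC)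
  · exact (hCS ▸ ⟨hxC, hxS⟩ : sSup x ∈ (∅ : Set Ordinal.{0}))
  · exact hcof.ne' (hx ▸ hScof _ hxS)

end PKL
end

section
/- Let κ be an inaccessible cardinal. Then the set E_0 = {x ∈ 𝒫_κ κ⁺ : x ∩ κ is a limit cardinal and cf(x ∩ κ) = cf(λ_x)} is stationary in 𝒫_κ κ⁺. -/
open Cardinal Set

namespace PKL

/-- A linear order with a strictly increasing cofinal `ω`-sequence has cofinality `ω`. -/
theorem cof_eq_aleph0_of_strictMono {α : Type*} [LinearOrder α] {f : ℕ → α}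
    (hf : StrictMono f) (hf' : ∀ a, ∃ n, a ≤ f n) : Order.cof α = ℵ₀ := by
  have h := Order.lift_cof_congr_of_strictMono hf (by simpa [IsCofinal] using hf')
  simpa using h.symm

/-- A set of fewer than `μ` ordinals below a regular cardinal `μ` is bounded below `μ`. -/
theorem exists_bound_of_isRegular {μ : Cardinal.{0}} (hμ : μ.IsRegular) {s : Set Ordinal.{0}}
    (hs : #s < Cardinal.lift.{1} μ) (hsμ : s ⊆ Iio μ.ord) :
    ∃ η < μ.ord, ∀ ξ ∈ s, ξ < η := by
  refine ⟨sSup ((· + 1) '' s), Ordinal.sSup_add_one_lt_of_lt_cof ?_ hsμ, fun ξ hξ ↦ ?_⟩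
  · rwa [← Ordinal.lift_cof, hμ.cof_ord]
  · refine lt_of_lt_of_le (Order.lt_add_one_iff.2 le_rfl) (le_csSup ⟨μ.ord, ?_⟩ ⟨ξ, hξ, rfl⟩)
    rintro _ ⟨β, hβ, rfl⟩
    exact Order.add_one_le_of_lt (hsμ hβ)

/-- Every member of a club of `𝒫_κ κ⁺` has a larger member `y` in the club which contains
an initial segment of `κ` ending at a cardinal above the trace of `x` on `κ`, and a strict
upper bound of `x`. -/
theorem IsClub.exists_extension {κ : Cardinal.{0}} (hκ : κ.IsInaccessible)
    {C : Set (Set Ordinal.{0})} (hC : IsClub κ (Iio (succOrd κ)) C) (x : C) :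
    ∃ (y : C) (c : Cardinal.{0}) (η : Ordinal.{0}), x.1 ⊆ y.1 ∧ ℵ₀ ≤ c ∧ c < κ ∧
      x.1 ∩ Iio κ.ord ⊆ Iio c.ord ∧ Iic c.ord ⊆ y.1 ∧ η ∈ y.1 ∧ ∀ ξ ∈ x.1, ξ < η := by
  obtain ⟨hxs, hxc⟩ := hC.1 x.2
  obtain ⟨b, hb, hxb⟩ := exists_bound_of_isRegular hκ.isRegular
    ((mk_le_mk_of_subset inter_subset_left).trans_lt hxc) (s := x.1 ∩ Iio κ.ord)
    inter_subset_right
  obtain ⟨η, hη, hxη⟩ := exists_bound_of_isRegular (isRegular_succ hκ.aleph0_lt.le)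
    (hxc.trans (Cardinal.lift_lt.2 (Order.lt_succ κ))) hxs
  set c := max ℵ₀ (Order.succ b.card) with hc
  have hcκ : c < κ := max_lt hκ.aleph0_lt (hκ.isSuccLimit.succ_lt (lt_ord.1 hb))
  have hbc : b < c.ord := lt_ord.2 ((Order.lt_succ _).trans_le (le_max_right _ _))
  have hκ' : ℵ₀ ≤ Cardinal.lift.{1} κ := by simpa using hκ.aleph0_lt.le
  have hIic : #(Iic c.ord) < Cardinal.lift.{1} κ := by
    have : Iic c.ord = Iio (c.ord + 1) := by ext; simp
    rw [this, mk_Iio_ordinal, Cardinal.lift_lt, ← lt_ord]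
    exact (isSuccLimit_ord hκ.aleph0_lt.le).add_one_lt (ord_lt_ord.2 hcκ)
  obtain ⟨y, hy, hxy⟩ := hC.2.1 (x.1 ∪ (Iic c.ord ∪ {η})) ⟨by
      refine union_subset hxs (union_subset (fun ξ hξ ↦ ?_) (singleton_subset_iff.2 hη))
      exact hξ.trans_lt (ord_lt_ord.2 (hcκ.trans (Order.lt_succ κ))),
    (mk_union_le _ _).trans_lt (add_lt_of_lt hκ' hxc
      ((mk_union_le _ _).trans_lt (add_lt_of_lt hκ' hIic (by
        simpa using one_lt_aleph0.trans_le hκ'))))⟩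
  exact ⟨⟨y, hy⟩, c, η, fun ξ hξ ↦ hxy (.inl hξ), le_max_left _ _, hcκ,
    fun ξ hξ ↦ (hxb ξ hξ).trans hbc, fun ξ hξ ↦ hxy (.inr (.inl hξ)),
    hxy (.inr (.inr rfl)), hxη⟩

/-- If `κ` is uncountable, a club of `𝒫_κ A` is closed under unions of increasing
`ω`-sequences. -/
theorem IsClub.iUnion_nat_mem {κ : Cardinal.{0}} (hκ : ℵ₀ < κ) {A : Set Ordinal.{0}}
    {C : Set (Set Ordinal.{0})} (hC : IsClub κ A C) {s : ℕ → Set Ordinal.{0}}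
    (hs : Monotone s) (hsC : ∀ n, s n ∈ C) : (⋃ n, s n) ∈ C := by
  have h := hC.2.2 Ordinal.omega0 Ordinal.omega0_pos (by rwa [lt_ord, Ordinal.card_omega0])
    (fun α ↦ s (Cardinal.toNat α.card)) (fun α β hαβ hβ ↦ ?_) (fun α _ ↦ hsC _)
  · convert h using 1
    ext ξ
    simp only [mem_iUnion, mem_Iio, exists_prop]
    constructor
    · rintro ⟨n, hn⟩
      exact ⟨n, Ordinal.natCast_lt_omega0 n, by simpa using hn⟩
    · rintro ⟨α, -, hα⟩
      exact ⟨_, hα⟩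
  · obtain ⟨n, rfl⟩ := Ordinal.lt_omega0.1 hβ
    obtain ⟨m, rfl⟩ := Ordinal.lt_omega0.1 (hαβ.trans_lt hβ)
    exact hs (by simpa using hαβ)

/-- The supremum of a strictly increasing `ω`-sequence of infinite cardinals is a limit
cardinal. -/
theorem isLimitCardOrd_ord_iSup {c : ℕ → Cardinal.{0}} (hc : StrictMono c)
    (hc₀ : ∀ n, ℵ₀ ≤ c n) : IsLimitCardOrd (⨆ n, c n).ord := by
  have hb := Cardinal.bddAbove_of_small (s := range c)
  refine ⟨by simp, ?_, ?_⟩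
  · simpa using (hc₀ 0).trans (le_ciSup hb 0)
  · intro d hd
    rw [card_ord] at hd ⊢
    obtain ⟨n, hn⟩ := (lt_ciSup_iff hb).1 hd
    exact ((Order.succ_le_of_lt hn).trans_lt (hc n.lt_succ_self)).trans_le (le_ciSup hb _)

/-- If `κ` is inaccessible then `E₀` is stationary in `𝒫_κ κ⁺`. -/
theorem stmt8 (κ : Cardinal.{0}) (hκ : κ.IsInaccessible) :
    IsStationary κ (Iio (succOrd κ)) (E0 κ) := by
  intro C hC
  choose Y c η hY hc₀ hcκ hxc hcY hηY hxη using hC.exists_extension hκ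
  obtain ⟨x₀, hx₀, -⟩ := hC.2.1 ∅ ⟨empty_subset _, by simpa using hκ.pos⟩
  let s : ℕ → C := fun n ↦ Y^[n] ⟨x₀, hx₀⟩
  have hs (n : ℕ) : s (n + 1) = Y (s n) := Function.iterate_succ_apply' Y n _
  have hmono : Monotone fun n ↦ (s n).1 :=
    monotone_nat_of_le_succ fun n ↦ by simpa only [hs] using hY (s n)
  have hcs (n : ℕ) : Iic (c (s n)).ord ⊆ (s (n + 1)).1 := by simpa only [hs] using hcY (s n)
  have hηs (n : ℕ) : η (s n) ∈ (s (n + 1)).1 := by simpa only [hs] using hηY (s n)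
  have hcmono : StrictMono fun n ↦ c (s n) := strictMono_nat_of_lt_succ fun n ↦
    ord_lt_ord.1 (hxc (s (n + 1)) ⟨hcs n self_mem_Iic, ord_lt_ord.2 (hcκ _)⟩)
  have hηmono : StrictMono fun n ↦ η (s n) := strictMono_nat_of_lt_succ fun n ↦
    hxη (s (n + 1)) _ (hηs n)
  have hxC : (⋃ n, (s n).1) ∈ C := hC.iUnion_nat_mem hκ.aleph0_lt hmono fun n ↦ (s n).2
  have hlt (ξ : Ordinal.{0}) : ξ < (⨆ n, c (s n)).ord ↔ ∃ n, ξ < (c (s n)).ord := by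
    simp only [lt_ord, lt_ciSup_iff (Cardinal.bddAbove_of_small (s := range fun n ↦ c (s n)))]
  refine ⟨_, ⟨hC.1 hxC, (⨆ n, c (s n)).ord, ?_,
    isLimitCardOrd_ord_iSup hcmono fun n ↦ hc₀ _, ?_⟩, hxC⟩
  · ext ξ
    rw [mem_Iio, hlt, mem_inter_iff, mem_iUnion]
    constructor
    · rintro ⟨⟨n, hn⟩, hξ⟩
      exact ⟨n, hxc _ ⟨hn, hξ⟩⟩
    · rintro ⟨n, hn⟩
      exact ⟨⟨n + 1, hcs n hn.le⟩, hn.trans (ord_lt_ord.2 (hcκ _))⟩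
  · rw [Ordinal.lift_cof, ← Ordinal.cof_Iio, otp, Ordinal.cof_type]
    rw [cof_eq_aleph0_of_strictMono
        (f := fun n ↦ (⟨(c (s n)).ord, (hlt _).2 ⟨n + 1, ord_lt_ord.2 (hcmono n.lt_succ_self)⟩⟩ :
          Iio (⨆ n, c (s n)).ord)) (fun m n h ↦ ord_lt_ord.2 (hcmono h)) ?_,
      cof_eq_aleph0_of_strictMono
        (f := fun n ↦ (⟨η (s n), mem_iUnion.2 ⟨n + 1, hηs n⟩⟩ : ⋃ n, (s n).1))
        (fun m n h ↦ hηmono h) ?_]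
    · rintro ⟨ξ, hξ⟩
      obtain ⟨n, hn⟩ := mem_iUnion.1 hξ
      exact ⟨n, (hxη _ ξ hn).le⟩
    · rintro ⟨ξ, hξ⟩
      obtain ⟨n, hn⟩ := (hlt ξ).1 hξ
      exact ⟨n, hn.le⟩

end PKL
end

section
/- Let κ be an inaccessible cardinal. For every a ∈ E_1 (that is, a ∈ 𝒫_κ κ⁺ with κ_a = a ∩ κ an inaccessible cardinal and the order type of a equal to κ_a⁺), the set E_0 ∩ 𝒫_{κ_a} a is stationary in 𝒫_{κ_a} a; in particular, E_0 reflects at every a ∈ E_1. -/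
open Cardinal Set

namespace PKL

theorem cof_otp_eq_aleph0 {s : Set Ordinal.{0}} {f : ℕ → Ordinal.{0}} (hf : StrictMono f)
    (hs : ∀ n, f n ∈ s) (hc : ∀ ξ ∈ s, ∃ n, ξ ≤ f n) : (otp s).cof = ℵ₀ := by
  let g : ℕ → s := fun n ↦ ⟨f n, hs n⟩
  have hg : StrictMono g := fun m n h ↦ hf h
  have h := Order.lift_cof_congr_of_strictMono hg (fun ξ ↦ by
    obtain ⟨n, hn⟩ := hc ξ.1 ξ.2
    exact ⟨g n, mem_range_self n, hn⟩)
  simpa [otp] using h.symm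

theorem IsClub.iUnion_mem {μ : Cardinal.{0}} {A : Set Ordinal.{0}} {C : Set (Set Ordinal.{0})}
    (hC : IsClub μ A C) (hμ : ℵ₀ < μ) {x : ℕ → Set Ordinal.{0}} (hx : Monotone x)
    (hxC : ∀ n, x n ∈ C) : (⋃ n, x n) ∈ C := by
  have h := hC.2.2 Ordinal.omega0 Ordinal.omega0_pos (by simpa [lt_ord] using hμ)
    (fun α ↦ ⋃ n ∈ {n : ℕ | (n : Ordinal) ≤ α}, x n)
    (fun α β hαβ _ ↦ biUnion_subset_biUnion_left fun n hn ↦ le_trans hn hαβ)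
    (fun α hα ↦ by
      obtain ⟨m, rfl⟩ := Ordinal.lt_omega0.1 hα
      convert hxC m using 1
      refine Subset.antisymm (iUnion₂_subset fun n hn ↦ hx (by simpa using hn))
        (subset_biUnion_of_mem (u := x) (by simp)))
  convert h using 1
  refine Subset.antisymm (iUnion_subset fun n ↦ ?_)
    (iUnion₂_subset fun α _ ↦ iUnion₂_subset fun n _ ↦ subset_iUnion x n)
  intro ξ hξ
  simp only [mem_iUnion]
  exact ⟨n, Ordinal.natCast_lt_omega0 n, n, by simp, hξ⟩

theorem PSet.union_mem {μ : Cardinal.{0}} (hμ : ℵ₀ ≤ μ) {A x y : Set Ordinal.{0}}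
    (hx : x ∈ PSet μ A) (hy : y ∈ PSet μ A) : x ∪ y ∈ PSet μ A :=
  ⟨union_subset hx.1 hy.1,
    (mk_union_le x y).trans_lt (add_lt_of_lt (by simpa using hμ) hx.2 hy.2)⟩

/-- A set of size `< μ` is bounded in a set of order type `μ⁺`. -/
theorem exists_forall_lt_of_otp_eq_succOrd {μ : Cardinal.{0}} (hμ : ℵ₀ ≤ μ)
    {A x : Set Ordinal.{0}} (hA : otp A = Ordinal.lift.{1} (succOrd μ)) (hx : x ∈ PSet μ A) :
    ∃ η ∈ A, ∀ ξ ∈ x, ξ < η := by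
  have hcof : Order.cof A = Cardinal.lift.{1} (Order.succ μ) := by
    rw [← Ordinal.cof_type, ← (isRegular_succ hμ).cof_ord, Ordinal.lift_cof]
    exact congrArg Ordinal.cof hA
  have hnot : ¬ IsCofinal (Subtype.val ⁻¹' x : Set A) := fun h ↦ by
    have h₁ := Order.cof_le h
    have h₂ : #(Subtype.val ⁻¹' x : Set A) ≤ #x :=
      mk_preimage_of_injective _ _ Subtype.val_injective
    rw [hcof] at h₁
    exact ((h₁.trans h₂).trans_lt hx.2).not_ge (lift_le.2 (Order.le_succ μ))
  obtain ⟨η, hη⟩ := not_isCofinal_iff.1 hnot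
  exact ⟨η, η.2, fun ξ hξ ↦ hη ⟨ξ, hx.1 hξ⟩ hξ⟩

/-- A set of fewer than `μ` ordinals below the initial ordinal of an inaccessible `μ` is bounded
by a cardinal below `μ`. -/
theorem exists_cardinal_of_subset_Iio {μ : Cardinal.{0}} (hμ : μ.IsInaccessible)
    {x : Set Ordinal.{0}} (hx : x ∈ PSet μ (Iio μ.ord)) :
    ∃ c < μ, x ⊆ Iio c.ord := by
  have hsup : sSup x < μ.ord := Ordinal.sSup_lt_of_lt_cof
    (by rw [← Ordinal.lift_cof, hμ.isRegular.cof_ord]; exact hx.2) hx.1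
  have hbdd : BddAbove x := ⟨μ.ord, fun ξ hξ ↦ (hx.1 hξ).le⟩
  refine ⟨Order.succ (sSup x).card, hμ.isSuccLimit.succ_lt (lt_ord.1 hsup), fun ξ hξ ↦ ?_⟩
  exact (le_csSup hbdd hξ).trans_lt (lt_ord.2 (Order.lt_succ _))

/-- One step of the construction: `y` extends `x`, is strictly longer, and contains the
successor of the cardinal `c` that bounds `x ∩ κ`. -/
structure Step (κ : Cardinal.{0}) (x y : Set Ordinal.{0}) (c : Cardinal.{0})
    (η : Ordinal.{0}) : Prop where
  subset : x ⊆ y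
  inter_subset : x ∩ Iio κ.ord ⊆ Iio c.ord
  Iio_subset : Iio (Order.succ c).ord ⊆ y ∩ Iio κ.ord
  mem : η ∈ y
  lt : ∀ ξ ∈ x, ξ < η

theorem exists_step {κ μ : Cardinal.{0}} (hμ : μ.IsInaccessible) {a : Set Ordinal.{0}}
    (ha : a ∩ Iio κ.ord = Iio μ.ord) (hotp : otp a = Ordinal.lift.{1} (succOrd μ))
    {C : Set (Set Ordinal.{0})} (hC : IsClub μ a C) {x : Set Ordinal.{0}} (hx : x ∈ C) :
    ∃ y ∈ C, ∃ c η, Step κ x y c η := by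
  have hxP := hC.1 hx
  have hμ₀ : ℵ₀ ≤ μ := hμ.isRegular.aleph0_le
  obtain ⟨η, hηa, hη⟩ := exists_forall_lt_of_otp_eq_succOrd hμ₀ hotp hxP
  obtain ⟨c, hcμ, hc⟩ := exists_cardinal_of_subset_Iio hμ (x := x ∩ Iio κ.ord)
    ⟨ha ▸ inter_subset_inter_left _ hxP.1, (mk_le_mk_of_subset inter_subset_left).trans_lt hxP.2⟩
  have hsucc := hμ.isSuccLimit.succ_lt hcμ
  have hI : Iio (Order.succ c).ord ⊆ a ∩ Iio κ.ord :=
    ha ▸ Iio_subset_Iio (ord_le_ord.2 hsucc.le)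
  have hIP : Iio (Order.succ c).ord ∈ PSet μ a :=
    ⟨hI.trans inter_subset_left, by
      rw [mk_Iio_ordinal, card_ord]
      exact lift_lt.2 hsucc⟩
  have hηP : {η} ∈ PSet μ a :=
    ⟨singleton_subset_iff.2 hηa, by simpa using one_lt_aleph0.trans_le hμ₀⟩
  obtain ⟨y, hyC, hy⟩ := hC.2.1 _ (PSet.union_mem hμ₀ (PSet.union_mem hμ₀ hxP hIP) hηP)
  rw [union_subset_iff, union_subset_iff, singleton_subset_iff] at hy
  exact ⟨y, hyC, c, η, hy.1.1, hc, subset_inter hy.1.2 (hI.trans inter_subset_right), hy.2, hη⟩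

theorem iUnion_mem_E0 {κ : Cardinal.{0}} {x : ℕ → Set Ordinal.{0}} {c : ℕ → Cardinal.{0}}
    {η : ℕ → Ordinal.{0}} (h : ∀ n, Step κ (x n) (x (n + 1)) (c n) (η n))
    (hx : (⋃ n, x n) ∈ PSet κ (Iio (succOrd κ))) : (⋃ n, x n) ∈ E0 κ := by
  have hx_mono : Monotone x := monotone_nat_of_le_succ fun n ↦ (h n).subset
  have hc_succ (n : ℕ) : Order.succ (c n) ≤ c (n + 1) :=
    ord_le_ord.1 (Iio_subset_Iio_iff.1 ((h n).Iio_subset.trans (h (n + 1)).inter_subset))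
  have hc : StrictMono c := strictMono_nat_of_lt_succ fun n ↦ Order.succ_le_iff.1 (hc_succ n)
  have hbdd : BddAbove (range c) := bddAbove_of_small
  have hlt {b : Cardinal.{0}} : b < ⨆ n, c n ↔ ∃ n, b < c n := lt_ciSup_iff hbdd
  have hcof : (Ordinal.cof (otp (Iio (⨆ n, c n).ord))) = ℵ₀ :=
    cof_otp_eq_aleph0 (f := fun n ↦ (c n).ord) (fun m n hmn ↦ ord_lt_ord.2 (hc hmn))
      (fun n ↦ ord_lt_ord.2 (hlt.2 ⟨n + 1, hc n.lt_succ_self⟩))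
      (fun ξ hξ ↦ by
        obtain ⟨n, hn⟩ := hlt.1 (lt_ord.1 hξ)
        exact ⟨n, (lt_ord.2 hn).le⟩)
  have hcof' : (otp (⋃ n, x n)).cof = ℵ₀ := by
    refine cof_otp_eq_aleph0 (f := η) (strictMono_nat_of_lt_succ fun n ↦
      (h (n + 1)).lt _ (h n).mem) (fun n ↦ mem_iUnion.2 ⟨n + 1, (h n).mem⟩) fun ξ hξ ↦ ?_
    obtain ⟨n, hn⟩ := mem_iUnion.1 hξ
    exact ⟨n, ((h n).lt ξ hn).le⟩
  refine ⟨hx, (⨆ n, c n).ord, ?_, ⟨by simp, ?_, fun b hb ↦ ?_⟩, ?_⟩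
  · refine Subset.antisymm ?_ fun ξ hξ ↦ ?_
    · rintro ξ ⟨hξ, hξκ⟩
      obtain ⟨n, hn⟩ := mem_iUnion.1 hξ
      exact ((h n).inter_subset ⟨hn, hξκ⟩).trans_le (ord_le_ord.2 (le_ciSup hbdd n))
    · obtain ⟨n, hn⟩ := hlt.1 (lt_ord.1 hξ)
      have hmem := (h n).Iio_subset
        ((lt_ord.2 hn).trans (ord_lt_ord.2 (Order.lt_succ _)))
      exact ⟨mem_iUnion.2 ⟨n + 1, hmem.1⟩, hmem.2⟩
  · rw [card_ord]
    refine aleph0_le.2 fun n ↦ ?_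
    have hn (n : ℕ) : (n : Cardinal) ≤ c n := by
      induction n with
      | zero => simp
      | succ n ih => simpa using (Order.succ_le_succ ih).trans (hc_succ n)
    exact (hn n).trans (le_ciSup hbdd n)
  · rw [card_ord] at hb ⊢
    obtain ⟨n, hn⟩ := hlt.1 hb
    exact hlt.2 ⟨n + 1, (Order.succ_le_of_lt hn).trans_lt (hc n.lt_succ_self)⟩
  · rw [hcof', ← hcof, Ordinal.lift_cof]
    exact congrArg Ordinal.cof (Ordinal.type_lt_Iio _).symm

/-- If `κ` is inaccessible then `E₀` reflects at every `a ∈ E₁`: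
`E₀ ∩ 𝒫_{κ_a} a` is stationary in `𝒫_{κ_a} a`. -/
theorem stmt9 (κ : Cardinal.{0}) (hκ : κ.IsInaccessible)
    (a : Set Ordinal.{0}) (ha : a ∈ E1 κ)
    (δ : Ordinal.{0}) (hδ : a ∩ Iio κ.ord = Iio δ) :
    IsStationary δ.card a (E0 κ ∩ PSet δ.card a) := by
  obtain ⟨⟨haκ, hcard⟩, δ', hδ', ⟨hord, hinacc⟩, hotp⟩ := ha
  obtain rfl : δ = δ' := Iio_injective (hδ.symm.trans hδ')
  intro C hC
  choose! y hyC c η hstep using fun x (hx : x ∈ C) ↦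
    exists_step hinacc (hδ.trans (congrArg Iio hord.symm)) hotp hC hx
  obtain ⟨x₀, hx₀, -⟩ := hC.2.1 ∅ ⟨empty_subset a, by
    rw [mk_eq_zero, ← lift_zero.{0, 1}, lift_lt]
    exact hinacc.pos⟩
  let x : ℕ → Set Ordinal.{0} := fun n ↦ y^[n] x₀
  have hxC (n : ℕ) : x n ∈ C := by
    induction n with
    | zero => exact hx₀
    | succ n ih => simpa only [x, Function.iterate_succ_apply'] using hyC _ ih
  have hx (n : ℕ) : Step κ (x n) (x (n + 1)) (c (x n)) (η (x n)) := by
    simpa only [x, Function.iterate_succ_apply'] using hstep _ (hxC n)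
  have hmem := hC.iUnion_mem hinacc.aleph0_lt
    (monotone_nat_of_le_succ fun n ↦ (hx n).subset) hxC
  have hsub := (hC.1 hmem).1
  exact ⟨⋃ n, x n, ⟨iUnion_mem_E0 hx ⟨hsub.trans haκ, (mk_le_mk_of_subset hsub).trans_lt hcard⟩,
    hC.1 hmem⟩, hmem⟩

end PKL
end

section
/- Let κ be a regular uncountable cardinal. Then the set {x ∈ 𝒫_κ κ⁺ : x ∩ κ is an ordinal and the order type of x is at most |x ∩ κ|⁺} contains a closed unbounded subset of 𝒫_κ κ⁺; that is, for almost all x ∈ 𝒫_κ κ⁺, λ_x ≤ κ_x⁺. -/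
open Cardinal Set

namespace PKL

/-- The sets in `𝒫_κ A` that are closed under a binary set-valued operation with values in
`𝒫_κ A` form a closed unbounded set. -/
theorem isClub_closed_under {κ : Cardinal.{0}} (hreg : κ.IsRegular) (hunc : ℵ₀ < κ)
    {A : Set Ordinal.{0}} {T : Ordinal.{0} → Ordinal.{0} → Set Ordinal.{0}}
    (hT : ∀ α ∈ A, ∀ β ∈ A, T α β ∈ PSet κ A) :
    IsClub κ A {x | x ∈ PSet κ A ∧ ∀ α ∈ x, ∀ β ∈ x, T α β ⊆ x} := by
  have hreg' : (Cardinal.lift.{1} κ).IsRegular := hreg.lift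
  refine ⟨fun x hx => hx.1, fun x hx => ?_, fun δ _ hδ f hmono hf => ?_⟩
  · let F : Set Ordinal.{0} → Set Ordinal.{0} := fun z => z ∪ ⋃ α ∈ z, ⋃ β ∈ z, T α β
    have hF : ∀ z ∈ PSet κ A, F z ∈ PSet κ A := by
      rintro z ⟨hzA, hz⟩
      refine ⟨union_subset hzA <| iUnion₂_subset fun α hα => iUnion₂_subset fun β hβ =>
        (hT α (hzA hα) β (hzA hβ)).1, ?_⟩
      refine (mk_union_le _ _).trans_lt (add_lt_of_lt hreg'.aleph0_le hz ?_)
      refine (card_biUnion_lt_iff_forall_of_isRegular hreg' hz).2 fun α hα => ?_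
      exact (card_biUnion_lt_iff_forall_of_isRegular hreg' hz).2 fun β hβ =>
        (hT α (hzA hα) β (hzA hβ)).2
    have hiter : ∀ n : ℕ, F^[n] x ∈ PSet κ A := by
      intro n
      induction n with
      | zero => exact hx
      | succ n ih => rw [Function.iterate_succ_apply']; exact hF _ ih
    have hmono : Monotone fun n : ℕ => F^[n] x := monotone_nat_of_le_succ fun n => by
      simp only [Function.iterate_succ_apply']
      exact subset_union_left
    refine ⟨⋃ n : ℕ, F^[n] x, ⟨⟨iUnion_subset fun n => (hiter n).1, ?_⟩, ?_⟩,
      subset_iUnion (fun n : ℕ => F^[n] x) 0⟩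
    · rw [← Equiv.ulift.{1}.surjective.iUnion_comp]
      refine (card_iUnion_lt_iff_forall_of_isRegular hreg' ?_).2 fun n => (hiter n.down).2
      simpa using hunc
    · intro α hα β hβ
      obtain ⟨m, hm⟩ := mem_iUnion.1 hα
      obtain ⟨n, hn⟩ := mem_iUnion.1 hβ
      refine Subset.trans ?_ (subset_iUnion _ (max m n + 1))
      rw [Function.iterate_succ_apply']
      refine Subset.trans ?_ subset_union_right
      exact subset_iUnion₂_of_subset α (hmono (le_max_left m n) hm) <|
        subset_iUnion₂_of_subset β (hmono (le_max_right m n) hn) Subset.rfl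
  · refine ⟨⟨iUnion₂_subset fun α hα => (hf α hα).1.1, ?_⟩, ?_⟩
    · refine (card_biUnion_lt_iff_forall_of_isRegular hreg' ?_).2 fun α hα => (hf α hα).1.2
      rw [mk_Iio_ordinal, Cardinal.lift_lt]
      exact lt_ord.1 hδ
    · intro α hα β hβ
      obtain ⟨i, hi, hαi⟩ := mem_iUnion₂.1 hα
      obtain ⟨j, hj, hβj⟩ := mem_iUnion₂.1 hβ
      have hij : max i j < δ := max_lt hi hj
      exact ((hf _ hij).2 α (hmono _ _ (le_max_left _ _) hij hαi) β
        (hmono _ _ (le_max_right _ _) hij hβj)).trans (subset_biUnion_of_mem (u := f) hij)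

/-- A set of ordinals whose proper initial segments have size at most `c` has order type at most
`c⁺`. -/
theorem otp_le_ord_succ {s : Set Ordinal.{0}} {c : Cardinal.{0}}
    (h : ∀ α ∈ s, #(s ∩ Iio α : Set Ordinal.{0}) ≤ Cardinal.lift.{1} c) :
    otp s ≤ Ordinal.lift.{1} (Order.succ c).ord := by
  rw [Cardinal.lift_ord, Cardinal.lift_succ]
  refine le_of_forall_lt fun o ho => ?_
  obtain ⟨⟨α, hα⟩, rfl⟩ := Ordinal.typein_surj _ ho
  rw [lt_ord, Ordinal.card_typein, Order.lt_succ_iff]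
  refine le_trans ?_ (h α hα)
  refine mk_le_of_injective
    (f := fun b => (⟨b.1.1, b.1.2, b.2⟩ : (s ∩ Iio α : Set Ordinal.{0}))) fun a b hab => ?_
  simpa [Subtype.ext_iff] using hab

/-- Every ordinal below `κ⁺` injects into `κ`. -/
theorem exists_injOn_of_lt_succOrd {κ : Cardinal.{0}} {α : Ordinal.{0}} (hα : α < succOrd κ) :
    ∃ g : Ordinal.{0} → Ordinal.{0}, MapsTo g (Iio α) (Iio κ.ord) ∧ InjOn g (Iio α) := by
  have hle : #(Iio α) ≤ #(Iio κ.ord) := by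
    rw [mk_Iio_ordinal, mk_Iio_ordinal, Cardinal.lift_le, card_ord]
    exact Order.lt_succ_iff.1 (lt_ord.1 hα)
  obtain ⟨e⟩ := hle
  refine ⟨fun β => if h : β < α then e ⟨β, h⟩ else 0, fun β hβ => ?_, fun β hβ γ hγ hβγ => ?_⟩
  · simp only [dif_pos (mem_Iio.1 hβ)]
    exact (e ⟨β, hβ⟩).2
  · simp only [dif_pos (mem_Iio.1 hβ), dif_pos (mem_Iio.1 hγ)] at hβγ
    exact congrArg Subtype.val (e.injective (Subtype.ext hβγ))

/-- For almost all `x ∈ 𝒫_κ κ⁺` (i.e. on a closed unbounded set), `x ∩ κ` is an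
ordinal and the order type of `x` is at most `|x ∩ κ|⁺`. -/
theorem stmt10 (κ : Cardinal.{0}) (hreg : κ.IsRegular) (hunc : ℵ₀ < κ) :
    ∃ C, IsClub κ (Iio (succOrd κ)) C ∧
      C ⊆ {x | ∃ δ : Ordinal.{0}, x ∩ Iio κ.ord = Iio δ ∧
        otp x ≤ Ordinal.lift.{1} ((Order.succ δ.card).ord)} := by
  have hg : ∀ α : Ordinal.{0}, ∃ g : Ordinal.{0} → Ordinal.{0}, α < succOrd κ →
      MapsTo g (Iio α) (Iio κ.ord) ∧ InjOn g (Iio α) := fun α => by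
    by_cases hα : α < succOrd κ
    · exact (exists_injOn_of_lt_succOrd hα).imp fun _ h _ => h
    · exact ⟨id, fun h => absurd h hα⟩
  choose g hg using hg
  let T : Ordinal.{0} → Ordinal.{0} → Set Ordinal.{0} := fun α β =>
    {γ | α < κ.ord ∧ γ < α} ∪ {γ | β < α ∧ γ = g α β}
  have hκ : κ.ord < succOrd κ := ord_lt_ord.2 (Order.lt_succ κ)
  have hT : ∀ α ∈ Iio (succOrd κ), ∀ β ∈ Iio (succOrd κ), T α β ∈ PSet κ (Iio (succOrd κ)) := by
    intro α hα β _
    refine ⟨union_subset (fun γ hγ => hγ.2.trans hα) ?_, ?_⟩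
    · rintro _ ⟨hβ, rfl⟩
      exact ((hg α hα).1 hβ).trans hκ
    · have hinf : ℵ₀ ≤ Cardinal.lift.{1} κ := hreg.lift.aleph0_le
      refine (mk_union_le _ _).trans_lt (add_lt_of_lt hinf ?_ ?_)
      · by_cases h : α < κ.ord
        · refine (mk_le_mk_of_subset (t := Iio α) fun γ hγ => hγ.2).trans_lt ?_
          rw [mk_Iio_ordinal, Cardinal.lift_lt]
          exact lt_ord.1 h
        · simpa [h] using hreg.pos
      · refine (mk_le_mk_of_subset (t := {g α β}) fun γ hγ => hγ.2).trans_lt ?_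
        rw [mk_singleton]
        exact one_lt_aleph0.trans_le hinf
  refine ⟨_, isClub_closed_under hreg hunc hT, ?_⟩
  rintro x ⟨⟨hxA, hx⟩, hcl⟩
  have hlower : IsLowerSet (x ∩ Iio κ.ord) := fun α β hβα hα => by
    rcases hβα.eq_or_lt with rfl | hlt
    · exact hα
    · exact ⟨hcl α hα.1 α hα.1 (Or.inl ⟨hα.2, hlt⟩), hlt.trans hα.2⟩
  obtain huniv | ⟨δ, hδ⟩ := hlower.eq_univ_or_Iio
  · exact (lt_irrefl κ.ord (huniv ▸ mem_univ κ.ord : κ.ord ∈ x ∩ Iio κ.ord).2).elim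
  refine ⟨δ, hδ, otp_le_ord_succ fun α hα => ?_⟩
  rw [← mk_Iio_ordinal, ← hδ]
  have hmaps : MapsTo (g α) (x ∩ Iio α) (x ∩ Iio κ.ord) := fun β hβ =>
    ⟨hcl α hα β hβ.1 (Or.inr ⟨hβ.2, rfl⟩), (hg α (hxA hα)).1 hβ.2⟩
  exact mk_le_of_injective
    (hmaps.restrict_inj.2 ((hg α (hxA hα)).2.mono inter_subset_right))

end PKL
end
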